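/- arXiv:2311.12780 — 2 statements merged into one kernel-verified Lean document; each statement's English description precedes it below -/
import Mathlib

section
/- Gaussian tail for the maximal excursion below a facet: Let a, b ∈ ℕ² with arg(a) > arg(b), and let P⁻_{a,b} be the uniform measure on oriented down-right paths from a to b that remain weakly below the segment [a,b]. Then there exist constants c, C, N₀ > 0 (independent of a, b) such that whenever ‖b − a‖ ≥ N₀, for all t ≥ 0, P⁻_{a,b}[ max_{x ∈ ω} d(x, [a,b]) ≥ t·‖b − a‖^{1/2} ] ≤ C·e^{−c t²}, where d(x, [a,b]) is the Euclidean distance from x to the segment [a,b]. -/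
def IsStep (p q : ℤ × ℤ) : Prop := q = (p.1 + 1, p.2) ∨ q = (p.1, p.2 - 1)

def IsPathFun (n : ℕ) (γ : ℕ → ℤ × ℤ) : Prop :=
  (∀ k, k < n → IsStep (γ k) (γ (k + 1))) ∧ ∀ k, n ≤ k → γ k = γ n

def IsLamPath (n : ℕ) (γ : ℕ → ℤ × ℤ) : Prop :=
  IsPathFun n γ ∧ (γ 0).1 = 0 ∧ (γ n).2 = 0 ∧ ∀ k, 0 ≤ (γ k).1 ∧ 0 ≤ (γ k).2

def IsPathBtw (n : ℕ) (x y : ℤ × ℤ) (γ : ℕ → ℤ × ℤ) : Prop :=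
  IsPathFun n γ ∧ γ 0 = x ∧ γ n = y

def pathArea (n : ℕ) (γ : ℕ → ℤ × ℤ) : ℤ :=
  ∑ k ∈ Finset.range n, if (γ (k + 1)).1 = (γ k).1 + 1 then (γ k).2 else 0

def emb (p : ℤ × ℤ) : ℝ × ℝ := ((p.1 : ℝ), (p.2 : ℝ))

/-- Euclidean distance from a point to a set of the plane. -/
noncomputable def eDist (p : ℝ × ℝ) (S : Set (ℝ × ℝ)) : ℝ :=
  sInf ((fun q : ℝ × ℝ => Real.sqrt ((p.1 - q.1) ^ 2 + (p.2 - q.2) ^ 2)) '' S)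

/-- `p` lies weakly below the line through `a` and `b` (for `a` upper-left of `b`). -/
def belowSeg (a b p : ℤ × ℤ) : Prop :=
  (b.1 - a.1) * (p.2 - a.2) ≤ (b.2 - a.2) * (p.1 - a.1)

namespace GT

lemma exp_le_add (x : ℝ) : Real.exp x ≤ x + Real.exp (x ^ 2) := by
  have h2 := Real.add_one_le_exp (x ^ 2)
  rcases le_total |x| 1 with h | h
  · have h1 := abs_le.1 (Real.abs_exp_sub_one_sub_id_le h)
    linarith [h1.2]
  · rcases le_abs'.1 h with h | h
    · have : Real.exp x ≤ 1 := Real.exp_le_one_iff.2 (by linarith)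
      nlinarith
    · have : Real.exp x ≤ Real.exp (x ^ 2) := Real.exp_le_exp.2 (by nlinarith)
      linarith

lemma two_point (p q u : ℝ) (hp : 0 ≤ p) (hq : 0 ≤ q) (hpq : p + q = 1) :
    p * Real.exp (q * u) + q * Real.exp (-(p * u)) ≤ Real.exp (u ^ 2) := by
  have h1 := exp_le_add (q * u)
  have h2 := exp_le_add (-(p * u))
  have hp1 : p ≤ 1 := by linarith
  have hq1 : q ≤ 1 := by linarith
  have h3 : Real.exp ((q * u) ^ 2) ≤ Real.exp (u ^ 2) := by
    apply Real.exp_le_exp.2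
    rw [mul_pow]
    nlinarith [sq_nonneg u, mul_nonneg hq hq, mul_le_mul hq1 hq1 hq zero_le_one]
  have h4 : Real.exp ((-(p * u)) ^ 2) ≤ Real.exp (u ^ 2) := by
    apply Real.exp_le_exp.2
    rw [neg_sq, mul_pow]
    nlinarith [sq_nonneg u, mul_nonneg hp hp, mul_le_mul hp1 hp1 hp zero_le_one]
  calc _ ≤ p * (q * u + Real.exp (u ^ 2)) + q * (-(p * u) + Real.exp (u ^ 2)) := by
        gcongr <;> linarith
    _ = (p + q) * Real.exp (u ^ 2) := by ring
    _ = _ := by rw [hpq, one_mul]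

/-- Paths of length `r` from `p` to `q`. -/
def PS (r : ℕ) (p q : ℤ × ℤ) : Set (ℕ → ℤ × ℤ) := {γ | IsPathBtw r p q γ}

def consP (p : ℤ × ℤ) (γ : ℕ → ℤ × ℤ) : ℕ → ℤ × ℤ := fun k => Nat.casesOn k p γ

@[simp] lemma consP_zero (p : ℤ × ℤ) (γ : ℕ → ℤ × ℤ) : consP p γ 0 = p := rfl
@[simp] lemma consP_succ (p : ℤ × ℤ) (γ : ℕ → ℤ × ℤ) (k : ℕ) : consP p γ (k + 1) = γ k := rfl

lemma consP_inj (p : ℤ × ℤ) : Function.Injective (consP p) := by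
  intro γ γ' h
  funext k
  exact congrFun h (k + 1)

lemma PS_zero_eq (p q : ℤ × ℤ) (h : p = q) : PS 0 p q = {fun _ => p} := by
  ext γ
  simp only [PS, IsPathBtw, IsPathFun, Set.mem_ofPred_eq, Set.mem_singleton_iff]
  constructor
  · rintro ⟨⟨_, h2⟩, h3, h4⟩
    funext k
    rw [h2 k (Nat.zero_le _), h3]
  · rintro rfl
    subst h
    simp

lemma PS_zero_ne (p q : ℤ × ℤ) (h : p ≠ q) : PS 0 p q = ∅ := by
  ext γ
  simp only [PS, IsPathBtw, Set.mem_ofPred_eq, Set.mem_empty_iff_false, iff_false]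
  rintro ⟨_, h3, h4⟩
  exact h (h3.symm.trans h4)

lemma consP_mem (r : ℕ) (p p' q : ℤ × ℤ) (γ : ℕ → ℤ × ℤ) (hs : IsStep p p') (h : γ ∈ PS r p' q) :
    consP p γ ∈ PS (r + 1) p q := by
  obtain ⟨⟨h1, h2⟩, h3, h4⟩ := h
  refine ⟨⟨?_, ?_⟩, rfl, h4⟩
  · intro k hk
    cases k with
    | zero => simpa [h3] using hs
    | succ k => exact h1 k (by omega)
  · intro k hk
    cases k with
    | zero => omega
    | succ k => exact h2 k (by omega)

lemma tail_mem (r : ℕ) (p q : ℤ × ℤ) (γ : ℕ → ℤ × ℤ) (h : γ ∈ PS (r + 1) p q) :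
    ∃ p' γ', IsStep p p' ∧ γ' ∈ PS r p' q ∧ γ = consP p γ' := by
  obtain ⟨⟨h1, h2⟩, h3, h4⟩ := h
  refine ⟨γ 1, fun k => γ (k + 1), ?_, ⟨⟨?_, ?_⟩, rfl, h4⟩, ?_⟩
  · simpa [h3] using h1 0 (by omega)
  · intro k hk
    exact h1 (k + 1) (by omega)
  · intro k hk
    exact h2 (k + 1) (by omega)
  · funext k
    cases k with
    | zero => exact h3
    | succ k => rfl

lemma PS_succ (r : ℕ) (p q : ℤ × ℤ) : PS (r + 1) p q =
    consP p '' PS r (p.1 + 1, p.2) q ∪ consP p '' PS r (p.1, p.2 - 1) q := by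
  ext γ
  constructor
  · intro h
    obtain ⟨p', γ', hs, hm, rfl⟩ := tail_mem r p q γ h
    rcases hs with rfl | rfl
    · exact Or.inl ⟨γ', hm, rfl⟩
    · exact Or.inr ⟨γ', hm, rfl⟩
  · rintro (⟨γ', hm, rfl⟩ | ⟨γ', hm, rfl⟩)
    · exact consP_mem r p _ q γ' (Or.inl rfl) hm
    · exact consP_mem r p _ q γ' (Or.inr rfl) hm

lemma PS_finite (r : ℕ) : ∀ p q : ℤ × ℤ, (PS r p q).Finite := by
  induction r with
  | zero =>
    intro p q
    by_cases h : p = q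
    · rw [PS_zero_eq p q h]; exact Set.finite_singleton _
    · rw [PS_zero_ne p q h]; exact Set.finite_empty
  | succ r ih =>
    intro p q
    rw [PS_succ]
    exact ((ih _ _).image _).union ((ih _ _).image _)

noncomputable def Z (r : ℕ) (p q : ℤ × ℤ) : ℝ := ((PS r p q).ncard : ℝ)

lemma Z_succ (r : ℕ) (p q : ℤ × ℤ) :
    Z (r + 1) p q = Z r (p.1 + 1, p.2) q + Z r (p.1, p.2 - 1) q := by
  unfold Z
  rw [PS_succ, Set.ncard_union_eq _ ((PS_finite _ _ _).image _) ((PS_finite _ _ _).image _),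
    Set.ncard_image_of_injective _ (consP_inj p), Set.ncard_image_of_injective _ (consP_inj p)]
  · push_cast; rfl
  · rw [Set.disjoint_left]
    rintro _ ⟨γ, h, rfl⟩ ⟨γ', h', he⟩
    rw [consP_inj p he] at h'
    have := h.2.1.symm.trans h'.2.1
    have := congrArg Prod.fst this
    simp at this

lemma Z_rel (r : ℕ) (q : ℤ × ℤ) : ∀ p : ℤ × ℤ, (q.1 - p.1) + (p.2 - q.2) = r + 1 →
    ((p.2 - q.2 : ℤ) : ℝ) * Z r (p.1 + 1, p.2) q = ((q.1 - p.1 : ℤ) : ℝ) * Z r (p.1, p.2 - 1) q := by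
  induction r with
  | zero =>
    intro p hp
    have e1 : ((p.2 - q.2 : ℤ) : ℝ) * Z 0 (p.1 + 1, p.2) q = 0 := by
      by_cases h : p.2 - q.2 = 0
      · rw [h]; simp
      · rw [Z, PS_zero_ne _ _ (by intro h'; apply h; rw [← h']; simp)]; simp
    have e2 : ((q.1 - p.1 : ℤ) : ℝ) * Z 0 (p.1, p.2 - 1) q = 0 := by
      by_cases h : q.1 - p.1 = 0
      · rw [h]; simp
      · rw [Z, PS_zero_ne _ _ (by intro h'; apply h; rw [← h']; simp)]; simp
    rw [e1, e2]
  | succ r ih =>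
    intro p hp
    have i1 := ih (p.1 + 1, p.2) (by push_cast at hp ⊢; linarith)
    have i2 := ih (p.1, p.2 - 1) (by push_cast at hp ⊢; linarith)
    rw [Z_succ, Z_succ]
    have hp' : ((q.1 : ℝ) - p.1) + (p.2 - q.2) = r + 1 + 1 := by exact_mod_cast hp
    simp only at i1 i2 ⊢
    push_cast at i1 i2 ⊢
    linear_combination i1 + i2

lemma Z_right (r : ℕ) (p q : ℤ × ℤ) (h : (q.1 - p.1) + (p.2 - q.2) = r + 1) :
    (r + 1 : ℝ) * Z r (p.1 + 1, p.2) q = ((q.1 - p.1 : ℤ) : ℝ) * Z (r + 1) p q := by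
  have := Z_rel r q p h
  have hp' : ((q.1 : ℝ) - p.1) + (p.2 - q.2) = r + 1 := by exact_mod_cast h
  rw [Z_succ]
  push_cast at this ⊢
  linear_combination this - Z r (p.1 + 1, p.2) q * hp'

lemma Z_down (r : ℕ) (p q : ℤ × ℤ) (h : (q.1 - p.1) + (p.2 - q.2) = r + 1) :
    (r + 1 : ℝ) * Z r (p.1, p.2 - 1) q = ((p.2 - q.2 : ℤ) : ℝ) * Z (r + 1) p q := by
  have := Z_rel r q p h
  have hp' : ((q.1 : ℝ) - p.1) + (p.2 - q.2) = r + 1 := by exact_mod_cast h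
  rw [Z_succ]
  push_cast at this ⊢
  linear_combination - this - Z r (p.1, p.2 - 1) q * hp'

/-- Position along a path: monotone. -/
lemma path_pos (r : ℕ) (p q : ℤ × ℤ) (γ : ℕ → ℤ × ℤ) (h : γ ∈ PS r p q) (k : ℕ) (hk : k ≤ r) :
    p.1 ≤ (γ k).1 ∧ (γ k).2 ≤ p.2 ∧ ((γ k).1 - p.1) + (p.2 - (γ k).2) = k := by
  induction k with
  | zero => rw [h.2.1]; simp
  | succ k ih =>
    obtain ⟨h1, h2, h3⟩ := ih (by omega)
    rcases h.1.1 k (by omega) with h' | h' <;> rw [h'] <;> push_cast <;>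
      refine ⟨?_, ?_, ?_⟩ <;> linarith

lemma path_pos' (r : ℕ) (p q : ℤ × ℤ) (γ : ℕ → ℤ × ℤ) (h : γ ∈ PS r p q) (k j : ℕ) (hk : k + j ≤ r) :
    (γ k).1 ≤ (γ (k + j)).1 ∧ (γ (k + j)).2 ≤ (γ k).2 := by
  induction j with
  | zero => simp
  | succ j ih =>
    obtain ⟨h1, h2⟩ := ih (by omega)
    rcases h.1.1 (k + j) (by omega) with h' | h' <;> rw [← add_assoc, h'] <;>
      refine ⟨?_, ?_⟩ <;> simp only <;> linarith

/-- Height functional. -/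
def H (m n : ℕ) (q p : ℤ × ℤ) : ℤ := n * (p.1 - q.1) + m * (p.2 - q.2)

lemma maximal (m n : ℕ) (q : ℤ × ℤ) (lam θ : ℝ) (r0 : ℕ) (hr0 : 1 ≤ r0) (J : ℕ) :
    ∀ (r : ℕ) (p : ℤ × ℤ), J + r0 ≤ r → (q.1 - p.1) + (p.2 - q.2) = r →
    (({γ | γ ∈ PS r p q ∧ ∃ j ≤ J, θ ≤ lam * H m n q (γ j) / ((r : ℝ) - j)}.ncard : ℕ) : ℝ) ≤
      Real.exp (lam * H m n q p / r - θ + lam ^ 2 * (m + n) ^ 2 * J / r0 ^ 2) * Z r p q := by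
  have triv : ∀ (J r : ℕ) (p : ℤ × ℤ), θ ≤ lam * H m n q p / r →
    (({γ | γ ∈ PS r p q ∧ ∃ j ≤ J, θ ≤ lam * H m n q (γ j) / ((r : ℝ) - j)}.ncard : ℕ) : ℝ) ≤
      Real.exp (lam * H m n q p / r - θ + lam ^ 2 * (m + n) ^ 2 * J / r0 ^ 2) * Z r p q := by
    intro J r p h
    have h1 : (({γ | γ ∈ PS r p q ∧ ∃ j ≤ J, θ ≤ lam * H m n q (γ j) / ((r : ℝ) - j)}.ncard : ℕ) : ℝ)
        ≤ Z r p q := by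
      unfold Z
      have hs : {γ | γ ∈ PS r p q ∧ ∃ j ≤ J, θ ≤ lam * H m n q (γ j) / ((r : ℝ) - j)} ⊆ PS r p q :=
        fun γ h => h.1
      exact_mod_cast Set.ncard_le_ncard hs (PS_finite _ _ _)
    have h2 : 1 ≤ Real.exp (lam * H m n q p / r - θ + lam ^ 2 * (m + n) ^ 2 * J / r0 ^ 2) := by
      apply Real.one_le_exp
      have : 0 ≤ lam ^ 2 * ((m : ℝ) + n) ^ 2 * J / r0 ^ 2 := by positivity
      linarith
    have h3 : 0 ≤ Z r p q := by unfold Z; positivity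
    nlinarith
  induction J with
  | zero =>
    intro r p hr hp
    by_cases h : θ ≤ lam * H m n q p / r
    · exact triv 0 r p h
    · have : {γ | γ ∈ PS r p q ∧ ∃ j ≤ 0, θ ≤ lam * H m n q (γ j) / ((r : ℝ) - j)} = ∅ := by
        ext γ
        simp only [Set.mem_ofPred_eq, Set.mem_empty_iff_false, iff_false]
        rintro ⟨hγ, j, hj, hh⟩
        obtain rfl : j = 0 := by omega
        rw [hγ.2.1] at hh
        simp at hh
        exact h hh
      rw [this]
      simp only [Set.ncard_empty, Nat.cast_zero]
      unfold Z; positivity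
  | succ J ih =>
    intro r p hr hp
    by_cases h : θ ≤ lam * H m n q p / r
    · exact triv _ r p h
    obtain ⟨r, rfl⟩ : ∃ s, r = s + 1 := ⟨r - 1, by omega⟩
    by_cases hne : (PS (r + 1) p q).Nonempty
    swap
    · have he : PS (r + 1) p q = ∅ := Set.not_nonempty_iff_eq_empty.1 hne
      simp [he, Z]
    obtain ⟨γ0, hγ0⟩ := hne
    have hx : 0 ≤ q.1 - p.1 := by
      have := (path_pos _ _ _ _ hγ0 (r + 1) le_rfl).1
      rw [hγ0.2.2] at this; linarith
    have hy : 0 ≤ p.2 - q.2 := by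
      have := (path_pos _ _ _ _ hγ0 (r + 1) le_rfl).2.1
      rw [hγ0.2.2] at this; linarith
    have i1 := ih r (p.1 + 1, p.2) (by omega) (by push_cast at hp ⊢; linarith)
    have i2 := ih r (p.1, p.2 - 1) (by omega) (by push_cast at hp ⊢; linarith)
    have hsub : {γ | γ ∈ PS (r + 1) p q ∧ ∃ j ≤ J + 1, θ ≤ lam * H m n q (γ j) / (((r + 1 : ℕ) : ℝ) - j)}
        ⊆ consP p '' {γ | γ ∈ PS r (p.1 + 1, p.2) q ∧ ∃ j ≤ J, θ ≤ lam * H m n q (γ j) / ((r : ℝ) - j)}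
        ∪ consP p '' {γ | γ ∈ PS r (p.1, p.2 - 1) q ∧ ∃ j ≤ J, θ ≤ lam * H m n q (γ j) / ((r : ℝ) - j)} := by
      rintro γ ⟨hγ, j, hj, hh⟩
      obtain ⟨p', γ', hs, hm, rfl⟩ := tail_mem r p q γ hγ
      cases j with
      | zero => simp at hh; push_cast at h; exact absurd hh h
      | succ j =>
        have hh' : θ ≤ lam * H m n q (γ' j) / ((r : ℝ) - j) := by
          push_cast at hh
          simpa using hh
        rcases hs with rfl | rfl
        · exact Or.inl ⟨γ', ⟨hm, j, by omega, hh'⟩, rfl⟩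
        · exact Or.inr ⟨γ', ⟨hm, j, by omega, hh'⟩, rfl⟩
    have hcard := (Set.ncard_le_ncard hsub ((((PS_finite _ _ _).subset (fun γ h => h.1)).image _).union
      (((PS_finite _ _ _).subset (fun γ h => h.1)).image _))).trans (Set.ncard_union_le _ _)
    rw [Set.ncard_image_of_injective _ (consP_inj p), Set.ncard_image_of_injective _ (consP_inj p)]
      at hcard
    have hcard' := ((Nat.cast_le (α := ℝ)).2 hcard).trans
      ((Nat.cast_add _ _).le.trans (add_le_add i1 i2))
    refine hcard'.trans ?_
    have hr1 : (1 : ℝ) ≤ r := by exact_mod_cast (by omega : 1 ≤ r)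
    have hrr0 : (r0 : ℝ) ≤ r := by exact_mod_cast (by omega : r0 ≤ r)
    have hr00 : (1 : ℝ) ≤ r0 := by exact_mod_cast hr0
    have zr := Z_right r p q (by push_cast at hp; exact hp)
    have zd := Z_down r p q (by push_cast at hp; exact hp)
    have hpR : ((q.1 - p.1 : ℤ) : ℝ) + ((p.2 - q.2 : ℤ) : ℝ) = r + 1 := by exact_mod_cast hp
    set x : ℝ := ((q.1 - p.1 : ℤ) : ℝ) with hxdef
    set y : ℝ := ((p.2 - q.2 : ℤ) : ℝ) with hydef
    have hx0 : 0 ≤ x := by rw [hxdef]; exact_mod_cast hx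
    have hy0 : 0 ≤ y := by rw [hydef]; exact_mod_cast hy
    have hrp : (0 : ℝ) < r + 1 := by positivity
    have zr' : Z r (p.1 + 1, p.2) q = x / (r + 1) * Z (r + 1) p q := by
      field_simp; linarith
    have zd' : Z r (p.1, p.2 - 1) q = y / (r + 1) * Z (r + 1) p q := by
      field_simp; linarith
    have hZ0 : 0 ≤ Z (r + 1) p q := by unfold Z; positivity
    have hH : (H m n q p : ℝ) = m * y - n * x := by
      simp only [H, hxdef, hydef]; push_cast; ring
    have hH1 : (H m n q (p.1 + 1, p.2) : ℝ) = m * y - n * x + n := by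
      simp only [H, hxdef, hydef]; push_cast; ring
    have hH2 : (H m n q (p.1, p.2 - 1) : ℝ) = m * y - n * x - m := by
      simp only [H, hxdef, hydef]; push_cast; ring
    rw [zr', zd', hH, hH1, hH2]
    set u : ℝ := lam * (m + n) / r with hu
    have tp := two_point (x / (r + 1)) (y / (r + 1)) u (by positivity) (by positivity)
      (by field_simp; linarith)
    set D : ℝ := lam * (m * y - n * x) / (r + 1) - θ + lam ^ 2 * (m + n) ^ 2 * J / r0 ^ 2 with hD
    have hyx : y = r + 1 - x := by linarith
    have e1 : lam * (m * y - n * x + n) / r - θ + lam ^ 2 * (m + n) ^ 2 * J / r0 ^ 2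
        = D + y / (r + 1) * u := by
      rw [hD, hu, hyx]; field_simp; ring
    have e2 : lam * (m * y - n * x - m) / r - θ + lam ^ 2 * (m + n) ^ 2 * J / r0 ^ 2
        = D + -(x / (r + 1) * u) := by
      rw [hD, hu, hyx]; field_simp; ring
    have e3 : D + u ^ 2 ≤ lam * (m * y - n * x) / ((r + 1 : ℕ) : ℝ) - θ
        + lam ^ 2 * (m + n) ^ 2 * ((J + 1 : ℕ) : ℝ) / r0 ^ 2 := by
      have : u ^ 2 ≤ lam ^ 2 * (m + n) ^ 2 / r0 ^ 2 := by
        rw [hu, div_pow, mul_pow]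
        gcongr
      rw [hD]; push_cast
      have e : lam ^ 2 * ((m : ℝ) + n) ^ 2 * (J + 1) / r0 ^ 2 =
        lam ^ 2 * ((m : ℝ) + n) ^ 2 * J / r0 ^ 2 + lam ^ 2 * (m + n) ^ 2 / r0 ^ 2 := by ring
      rw [e]; linarith
    rw [e1, e2, Real.exp_add D, Real.exp_add D]
    calc _ = Real.exp D * (x / (r + 1) * Real.exp (y / (r + 1) * u)
          + y / (r + 1) * Real.exp (-(x / (r + 1) * u))) * Z (r + 1) p q := by ring
      _ ≤ Real.exp D * Real.exp (u ^ 2) * Z (r + 1) p q := by gcongr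
      _ = Real.exp (D + u ^ 2) * Z (r + 1) p q := by rw [Real.exp_add D]
      _ ≤ _ := by gcongr

/-- Closed cyclic walks with steps `n` and `-m`. -/
def W (m n : ℕ) : Set (ZMod (m + n) → ℤ) :=
  {h | h 0 = 0 ∧ ∀ i, h (i + 1) = h i + n ∨ h (i + 1) = h i - m}

lemma W_bound (m n : ℕ) (h : ZMod (m + n) → ℤ) (hh : h ∈ W m n) (k : ℕ) :
    -((m : ℤ) * k) ≤ h (k : ZMod (m + n)) ∧ h (k : ZMod (m + n)) ≤ n * k := by
  induction k with
  | zero => simp [hh.1]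
  | succ k ih =>
    push_cast
    have hm : (0 : ℤ) ≤ m := by positivity
    have hn : (0 : ℤ) ≤ n := by positivity
    rcases hh.2 (k : ZMod (m + n)) with e | e <;> rw [e] <;> constructor <;> linarith [ih.1, ih.2]

lemma W_finite (m n : ℕ) [NeZero (m + n)] : (W m n).Finite := by
  apply Set.Finite.subset (Set.Finite.pi' (ι := ZMod (m + n)) (fun i => Set.finite_Icc
    (-((m : ℤ) * i.val)) ((n : ℤ) * i.val)))
  intro h hh i
  have := W_bound m n h hh i.val
  rw [ZMod.natCast_zmod_val] at this
  exact this

lemma W_mod (m n : ℕ) [NeZero (m + n)] (h : ZMod (m + n) → ℤ) (hh : h ∈ W m n) (i : ZMod (m + n)) :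
    ((h i : ℤ) : ZMod (m + n)) = n * i := by
  have key : ∀ k : ℕ, ((h (k : ZMod (m + n)) : ℤ) : ZMod (m + n)) = n * k := by
    intro k
    induction k with
    | zero => simp [hh.1]
    | succ k ih =>
      have h0 : ((m : ZMod (m + n)) + n) = 0 := by
        have := ZMod.natCast_self (m + n)
        push_cast at this
        exact this
      push_cast
      rcases hh.2 (k : ZMod (m + n)) with e | e <;> rw [e] <;> push_cast <;> rw [ih]
      · ring
      · linear_combination - h0
  have := key i.val
  rwa [ZMod.natCast_zmod_val] at this

lemma W_lt (m n : ℕ) [NeZero (m + n)] (a b : ZMod (m + n) → ℤ) (ha : a ∈ W m n) (hb : b ∈ W m n)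
    (i : ZMod (m + n)) (h : a i < b i) : a (i + 1) ≤ b (i + 1) := by
  have h1 : ((a i : ℤ) : ZMod (m + n)) = ((b i : ℤ) : ZMod (m + n)) := by
    rw [W_mod m n a ha, W_mod m n b hb]
  rw [ZMod.intCast_eq_intCast_iff_dvd_sub] at h1
  have h2 := Int.le_of_dvd (by linarith) h1
  push_cast at h2
  rcases ha.2 i with e | e <;> rcases hb.2 i with e' | e' <;> rw [e, e'] <;> omega

lemma W_inf (m n : ℕ) [NeZero (m + n)] (a b : ZMod (m + n) → ℤ) (ha : a ∈ W m n) (hb : b ∈ W m n) :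
    a ⊓ b ∈ W m n := by
  refine ⟨by simp [ha.1, hb.1], fun i => ?_⟩
  have h1 := W_lt m n a b ha hb i
  have h2 := W_lt m n b a hb ha i
  have h3 := ha.2 i
  have h4 := hb.2 i
  simp only [Pi.inf_apply]
  omega

lemma W_sup (m n : ℕ) [NeZero (m + n)] (a b : ZMod (m + n) → ℤ) (ha : a ∈ W m n) (hb : b ∈ W m n) :
    a ⊔ b ∈ W m n := by
  refine ⟨by simp [ha.1, hb.1], fun i => ?_⟩
  have h1 := W_lt m n a b ha hb i
  have h2 := W_lt m n b a hb ha i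
  have h3 := ha.2 i
  have h4 := hb.2 i
  simp only [Pi.sup_apply]
  omega

def sh {N : ℕ} (j : ZMod N) (h : ZMod N → ℤ) : ZMod N → ℤ := fun i => h (i + j) - h j

lemma sh_mem (m n : ℕ) (j : ZMod (m + n)) (h : ZMod (m + n) → ℤ) (hh : h ∈ W m n) :
    sh j h ∈ W m n := by
  refine ⟨by simp [sh], fun i => ?_⟩
  simp only [sh]
  have := hh.2 (i + j)
  rw [show i + 1 + j = i + j + 1 by ring]
  omega

lemma sh_sh {N : ℕ} (j : ZMod N) (h : ZMod N → ℤ) (h0 : h 0 = 0) : sh (-j) (sh j h) = h := by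
  funext i
  simp [sh, h0]

lemma sh_sh' {N : ℕ} (j : ZMod N) (h : ZMod N → ℤ) (h0 : h 0 = 0) : sh j (sh (-j) h) = h := by
  funext i
  simp [sh, h0]

open Classical in
noncomputable def amax {N : ℕ} [NeZero N] (h : ZMod N → ℤ) : Finset (ZMod N) :=
  Finset.univ.filter (fun j => ∀ i, h i ≤ h j)

lemma mem_amax {N : ℕ} [NeZero N] (h : ZMod N → ℤ) (j : ZMod N) : j ∈ amax h ↔ ∀ i, h i ≤ h j := by
  simp [amax]

lemma mem_amax_sh {N : ℕ} [NeZero N] (h : ZMod N → ℤ) (j k : ZMod N) :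
    k ∈ amax (sh j h) ↔ k + j ∈ amax h := by
  simp only [mem_amax, sh]
  constructor
  · intro H i
    have := H (i - j)
    rw [sub_add_cancel] at this
    linarith
  · intro H i
    have := H (i + j)
    linarith

lemma card_amax_sh {N : ℕ} [NeZero N] (h : ZMod N → ℤ) (j : ZMod N) :
    (amax (sh j h)).card = (amax h).card :=
  Finset.card_equiv (Equiv.addRight j) (fun k => by simp [mem_amax_sh])

lemma amax_nonempty {N : ℕ} [NeZero N] (h : ZMod N → ℤ) : (amax h).Nonempty := by
  obtain ⟨j, hj⟩ := Finite.exists_max h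
  exact ⟨j, (mem_amax h j).2 hj⟩

noncomputable def WF (m n : ℕ) [NeZero (m + n)] : Finset (ZMod (m + n) → ℤ) := (W_finite m n).toFinset

lemma mem_WF (m n : ℕ) [NeZero (m + n)] (h : ZMod (m + n) → ℤ) : h ∈ WF m n ↔ h ∈ W m n := by
  simp [WF]

open Classical in
noncomputable def EF (m n : ℕ) [NeZero (m + n)] : Finset (ZMod (m + n) → ℤ) :=
  (WF m n).filter (fun h => ∀ i, h i ≤ 0)

lemma mem_EF (m n : ℕ) [NeZero (m + n)] (h : ZMod (m + n) → ℤ) :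
    h ∈ EF m n ↔ h ∈ W m n ∧ ∀ i, h i ≤ 0 := by
  simp [EF, mem_WF]

open Classical in
lemma cyc (m n : ℕ) [NeZero (m + n)] (B : (ZMod (m + n) → ℤ) → Prop)
    (hB : ∀ j h, B (sh j h) ↔ B h) :
    (((WF m n).filter B).card : ℝ) =
      (m + n : ℕ) * ∑ e ∈ (EF m n).filter B, (1 : ℝ) / (amax e).card := by
  have h1 : ∀ h ∈ (WF m n).filter B, (1 : ℝ) = ∑ j : ZMod (m + n),
      if j ∈ amax h then (1 : ℝ) / (amax h).card else 0 := by
    intro h _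
    rw [← Finset.sum_filter]
    have : (Finset.univ.filter (fun j => j ∈ amax h)) = amax h := by ext; simp
    rw [this, Finset.sum_const, nsmul_eq_mul]
    have : ((amax h).card : ℝ) ≠ 0 := by
      exact_mod_cast (Finset.card_pos.2 (amax_nonempty h)).ne'
    field_simp
  rw [Finset.card_eq_sum_ones, Nat.cast_sum]
  push_cast
  rw [Finset.sum_congr rfl h1, Finset.sum_comm]
  have h2 : ∀ j : ZMod (m + n), (∑ h ∈ (WF m n).filter B,
      if j ∈ amax h then (1 : ℝ) / (amax h).card else 0) =
      ∑ e ∈ (EF m n).filter B, (1 : ℝ) / (amax e).card := by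
    intro j
    rw [← Finset.sum_filter]
    refine Finset.sum_bij' (fun h _ => sh j h) (fun h _ => sh (-j) h) ?_ ?_ ?_ ?_ ?_
    · intro h hh
      simp only [Finset.mem_filter, mem_WF, mem_EF, mem_amax] at hh ⊢
      refine ⟨⟨sh_mem m n j h hh.1.1, fun i => ?_⟩, (hB j h).2 hh.1.2⟩
      have := hh.2 (i + j)
      simp only [sh]; linarith
    · intro h hh
      simp only [Finset.mem_filter, mem_WF, mem_EF] at hh ⊢
      refine ⟨⟨sh_mem m n _ h hh.1.1, (hB _ h).2 hh.2⟩, ?_⟩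
      rw [mem_amax_sh, add_neg_cancel, mem_amax]
      intro i
      rw [hh.1.1.1]; exact hh.1.2 i
    · intro h hh
      simp only [Finset.mem_filter, mem_WF] at hh
      exact sh_sh j h hh.1.1.1
    · intro h hh
      simp only [Finset.mem_filter, mem_EF] at hh
      exact sh_sh' j h hh.1.1.1
    · intro h _
      rw [card_amax_sh]
  rw [Finset.sum_congr rfl (fun j _ => h2 j), Finset.sum_const, Finset.card_univ, ZMod.card,
    nsmul_eq_mul]
  push_cast
  rfl

lemma card_amax_mono (m n : ℕ) [NeZero (m + n)] (a b : ZMod (m + n) → ℤ) (ha : a ∈ EF m n)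
    (hb : b ∈ EF m n) (hab : a ≤ b) : (amax a).card ≤ (amax b).card := by
  rw [mem_EF] at ha hb
  apply Finset.card_le_card
  intro j hj
  rw [mem_amax] at hj ⊢
  intro i
  have h1 := hj 0
  rw [ha.1.1] at h1
  exact (hb.2 i).trans (h1.trans (hab j))

open Classical FinsetFamily in
lemma fkgE (m n : ℕ) [NeZero (m + n)] (B : (ZMod (m + n) → ℤ) → Prop)
    (hB : ∀ a ∈ EF m n, ∀ b ∈ EF m n, a ≤ b → B b → B a) :
    (((EF m n).filter B).card : ℝ) * (∑ e ∈ EF m n, (1 : ℝ) / (amax e).card) ≤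
      (∑ e ∈ (EF m n).filter B, (1 : ℝ) / (amax e).card) * ((EF m n).card : ℝ) := by
  have hinf : ∀ a ∈ EF m n, ∀ b ∈ EF m n, a ⊓ b ∈ EF m n := by
    intro a ha b hb
    rw [mem_EF] at ha hb ⊢
    exact ⟨W_inf m n a b ha.1 hb.1, fun i => inf_le_left.trans (ha.2 i)⟩
  have hsup : ∀ a ∈ EF m n, ∀ b ∈ EF m n, a ⊔ b ∈ EF m n := by
    intro a ha b hb
    rw [mem_EF] at ha hb ⊢
    exact ⟨W_sup m n a b ha.1 hb.1, fun i => sup_le (ha.2 i) (hb.2 i)⟩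
  let f₁ : (ZMod (m + n) → ℤ) → ℝ := fun h => if h ∈ EF m n ∧ B h then 1 else 0
  let f₂ : (ZMod (m + n) → ℤ) → ℝ := fun h => if h ∈ EF m n then 1 / (amax h).card else 0
  let f₃ : (ZMod (m + n) → ℤ) → ℝ := fun h => if h ∈ EF m n ∧ B h then 1 / (amax h).card else 0
  let f₄ : (ZMod (m + n) → ℤ) → ℝ := fun h => if h ∈ EF m n then 1 else 0
  have n1 : 0 ≤ f₁ := fun h => by simp only [f₁]; split_ifs <;> simp
  have n2 : 0 ≤ f₂ := fun h => by simp only [f₂]; split_ifs <;> simp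
  have n3 : 0 ≤ f₃ := fun h => by simp only [f₃]; split_ifs <;> simp
  have n4 : 0 ≤ f₄ := fun h => by simp only [f₄]; split_ifs <;> simp
  have key := four_functions_theorem f₁ f₂ f₃ f₄ n1 n2 n3 n4 (by
    intro a b
    by_cases ha : a ∈ EF m n ∧ B a
    swap
    · have : f₁ a = 0 := by simp only [f₁]; rw [if_neg ha]
      rw [this, zero_mul]; exact mul_nonneg (n3 _) (n4 _)
    by_cases hb : b ∈ EF m n
    swap
    · have : f₂ b = 0 := by simp only [f₂]; rw [if_neg hb]
      rw [this, mul_zero]; exact mul_nonneg (n3 _) (n4 _)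
    have hi := hinf a ha.1 b hb
    have e3 : a ⊓ b ∈ EF m n ∧ B (a ⊓ b) := ⟨hi, hB _ hi a ha.1 inf_le_left ha.2⟩
    simp only [f₁, f₂, f₃, f₄]
    rw [if_pos ha, if_pos hb, if_pos e3, if_pos (hsup a ha.1 b hb), one_mul, mul_one]
    have hc := card_amax_mono m n _ _ hi hb inf_le_right
    have hp : 0 < ((amax (a ⊓ b)).card : ℝ) := by
      exact_mod_cast Finset.card_pos.2 (amax_nonempty _)
    exact one_div_le_one_div_of_le hp (by exact_mod_cast hc)) (EF m n) (EF m n)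
  have s1 : ∑ a ∈ EF m n, f₁ a = (((EF m n).filter B).card : ℝ) := by
    rw [Finset.card_filter]; push_cast
    exact Finset.sum_congr rfl (fun h hh => by simp [f₁, hh])
  have s2 : ∑ a ∈ EF m n, f₂ a = ∑ e ∈ EF m n, (1 : ℝ) / (amax e).card :=
    Finset.sum_congr rfl (fun h hh => by simp [f₂, hh])
  have s3 : ∑ a ∈ EF m n ⊼ EF m n, f₃ a ≤ ∑ e ∈ (EF m n).filter B, (1 : ℝ) / (amax e).card := by
    rw [Finset.sum_filter]
    calc _ ≤ ∑ a ∈ EF m n, f₃ a := by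
          apply Finset.sum_le_sum_of_subset_of_nonneg
          · intro h hh
            obtain ⟨a, ha, b, hb, rfl⟩ := Finset.mem_infs.1 hh
            exact hinf a ha b hb
          · intro h _ _; exact n3 h
      _ = _ := Finset.sum_congr rfl (fun h hh => by simp [f₃, hh])
  have s4 : ∑ a ∈ EF m n ⊻ EF m n, f₄ a ≤ ((EF m n).card : ℝ) := by
    calc _ ≤ ∑ a ∈ EF m n, f₄ a := by
          apply Finset.sum_le_sum_of_subset_of_nonneg
          · intro h hh
            obtain ⟨a, ha, b, hb, rfl⟩ := Finset.mem_sups.1 hh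
            exact hsup a ha b hb
          · intro h _ _; exact n4 h
      _ = ∑ a ∈ EF m n, 1 := Finset.sum_congr rfl (fun h hh => by simp [f₄, hh])
      _ = _ := by simp
  rw [s1, s2] at key
  refine key.trans (mul_le_mul s3 s4 (Finset.sum_nonneg fun h _ => n4 h)
    (Finset.sum_nonneg fun h _ => by positivity))

def Bad {N : ℕ} (T : ℝ) (h : ZMod N → ℤ) : Prop := ∃ i j, T ≤ ((h i - h j : ℤ) : ℝ)

lemma Bad_sh {N : ℕ} (T : ℝ) (j : ZMod N) (h : ZMod N → ℤ) : Bad T (sh j h) ↔ Bad T h := by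
  constructor
  · rintro ⟨i, k, hk⟩
    refine ⟨i + j, k + j, ?_⟩
    simp only [sh] at hk
    rwa [sub_sub_sub_cancel_right] at hk
  · rintro ⟨i, k, hk⟩
    refine ⟨i - j, k - j, ?_⟩
    simp only [sh]
    rwa [sub_sub_sub_cancel_right, sub_add_cancel, sub_add_cancel]

open Classical in
lemma compare (m n : ℕ) [NeZero (m + n)] (T : ℝ) :
    (((EF m n).filter (Bad T)).card : ℝ) * ((WF m n).card : ℝ) ≤
      (((WF m n).filter (Bad T)).card : ℝ) * ((EF m n).card : ℝ) := by
  have h1 := cyc m n (Bad T) (Bad_sh T)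
  have h2 := cyc m n (fun _ => True) (fun _ _ => Iff.rfl)
  rw [Finset.filter_true, Finset.filter_true] at h2
  have h3 := fkgE m n (Bad T) (by
    rintro a ha b hb hab ⟨i, j, hij⟩
    rw [mem_EF] at ha hb
    refine ⟨0, j, hij.trans ?_⟩
    rw [ha.1.1]
    have := hab j
    have := hb.2 i
    exact_mod_cast (by linarith : b i - b j ≤ 0 - a j))
  rw [h1, h2]
  have h4 : (0 : ℝ) ≤ (m + n : ℕ) := by positivity
  nlinarith [mul_le_mul_of_nonneg_left h3 h4]

lemma card_sub {α : Type*} (P : α → Prop) : Nat.card {x // P x} = {x | P x}.ncard := by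
  rw [← Nat.card_coe_set_eq]; rfl

def Psi (m n : ℕ) (b : ℤ × ℤ) (γ : ℕ → ℤ × ℤ) : ZMod (m + n) → ℤ := fun i => H m n b (γ i.val)

lemma Psi_nat (m n : ℕ) [NeZero (m + n)] (a b : ℤ × ℤ) (hm : b.1 - a.1 = m) (hn : a.2 - b.2 = n)
    (γ : ℕ → ℤ × ℤ) (hγ : γ ∈ PS (m + n) a b) (k : ℕ) (hk : k ≤ m + n) :
    Psi m n b γ (k : ZMod (m + n)) = H m n b (γ k) := by
  rcases hk.lt_or_eq with h | h
  · simp only [Psi]; rw [ZMod.val_natCast_of_lt h]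
  · have e : ((k : ℕ) : ZMod (m + n)) = 0 := by rw [h]; exact ZMod.natCast_self _
    rw [e, h, hγ.2.2]
    simp only [Psi, ZMod.val_zero]
    rw [hγ.2.1]
    simp only [H]
    rw [hn, show a.1 - b.1 = -m by linarith]
    ring

lemma Psi_mem (m n : ℕ) [NeZero (m + n)] (a b : ℤ × ℤ) (hm : b.1 - a.1 = m) (hn : a.2 - b.2 = n)
    (γ : ℕ → ℤ × ℤ) (hγ : γ ∈ PS (m + n) a b) : Psi m n b γ ∈ W m n := by
  constructor
  · simp only [Psi, ZMod.val_zero]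
    rw [hγ.2.1]
    simp only [H]
    rw [hn, show a.1 - b.1 = -m by linarith]
    ring
  · intro i
    have hi : i.val < m + n := ZMod.val_lt i
    have e1 := Psi_nat m n a b hm hn γ hγ i.val hi.le
    have e2 := Psi_nat m n a b hm hn γ hγ (i.val + 1) hi
    rw [Nat.cast_add, ZMod.natCast_zmod_val, Nat.cast_one] at e2
    rw [ZMod.natCast_zmod_val] at e1
    rw [e1, e2]
    rcases hγ.1.1 i.val hi with h | h <;> rw [h] <;> simp only [H]
    · left; ring
    · right; ring

lemma Psi_inj (m n : ℕ) [NeZero (m + n)] (a b : ℤ × ℤ) (hm : b.1 - a.1 = m) (hn : a.2 - b.2 = n) :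
    Set.InjOn (Psi m n b) (PS (m + n) a b) := by
  intro γ hγ γ' hγ' he
  have key : ∀ k ≤ m + n, γ k = γ' k := by
    intro k hk
    have e := congrFun he (k : ZMod (m + n))
    rw [Psi_nat m n a b hm hn γ hγ k hk, Psi_nat m n a b hm hn γ' hγ' k hk] at e
    have h1 := (path_pos _ _ _ _ hγ k hk).2.2
    have h2 := (path_pos _ _ _ _ hγ' k hk).2.2
    simp only [H] at e
    have h3 : ((m : ℤ) + n) * ((γ k).1 - (γ' k).1) = 0 := by
      linear_combination e + m * (h1 - h2)
    have h4 : ((m : ℤ) + n) ≠ 0 := by exact_mod_cast NeZero.ne (m + n)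
    have h5 := (mul_eq_zero.1 h3).resolve_left h4
    ext <;> linarith
  funext k
  rcases le_total k (m + n) with h | h
  · exact key k h
  · rw [hγ.1.2 k h, hγ'.1.2 k h, key _ le_rfl]

open Classical in
noncomputable def ups (m n : ℕ) (h : ZMod (m + n) → ℤ) (k : ℕ) : ℤ :=
  ∑ j ∈ Finset.range k, if h ((j : ZMod (m + n)) + 1) = h j + n then 1 else 0

lemma ups_h (m n : ℕ) (h : ZMod (m + n) → ℤ) (hh : h ∈ W m n) (k : ℕ) :
    h (k : ZMod (m + n)) = n * ups m n h k - m * (k - ups m n h k) := by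
  induction k with
  | zero => simp [ups, hh.1]
  | succ k ih =>
    have e : ups m n h (k + 1) = ups m n h k +
      if h ((k : ZMod (m + n)) + 1) = h k + n then 1 else 0 := Finset.sum_range_succ _ _
    rw [e]
    push_cast
    split_ifs with hc
    · rw [hc, ih]; ring
    · rw [(hh.2 k).resolve_left hc, ih]; ring

lemma Psi_surj (m n : ℕ) [NeZero (m + n)] (a b : ℤ × ℤ) (hm : b.1 - a.1 = m) (hn : a.2 - b.2 = n)
    (h : ZMod (m + n) → ℤ) (hh : h ∈ W m n) : ∃ γ ∈ PS (m + n) a b, Psi m n b γ = h := by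
  have h4 : ((m : ℤ) + n) ≠ 0 := by exact_mod_cast NeZero.ne (m + n)
  have hN : ups m n h (m + n) = m := by
    have := ups_h m n h hh (m + n)
    rw [ZMod.natCast_self, hh.1] at this
    push_cast at this
    have h3 : ((m : ℤ) + n) * (ups m n h (m + n) - m) = 0 := by linear_combination - this
    have := (mul_eq_zero.1 h3).resolve_left h4
    linarith
  let g : ℕ → ℤ × ℤ := fun k => (a.1 + ups m n h k, a.2 - (k - ups m n h k))
  refine ⟨fun k => g (min k (m + n)), ⟨⟨?_, ?_⟩, ?_, ?_⟩, ?_⟩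
  · intro k hk
    beta_reduce
    rw [min_eq_left hk.le, min_eq_left (by omega : k + 1 ≤ m + n)]
    have e : ups m n h (k + 1) = ups m n h k +
      if h ((k : ZMod (m + n)) + 1) = h k + n then 1 else 0 := Finset.sum_range_succ _ _
    simp only [g, IsStep]
    rw [e]
    push_cast
    split_ifs
    · left; ext <;> simp <;> ring
    · right; ext <;> simp; ring
  · intro k hk
    simp [min_eq_right hk]
  · simp [g, ups]
  · simp only [min_self, g]
    rw [hN]
    ext <;> push_cast <;> linarith
  · funext i
    have hi : i.val < m + n := ZMod.val_lt i
    have := ups_h m n h hh i.val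
    rw [ZMod.natCast_zmod_val] at this
    simp only [Psi, min_eq_left hi.le, g, H]
    rw [this]
    linear_combination n * (-hm) + m * hn

lemma card_transfer (m n : ℕ) [NeZero (m + n)] (a b : ℤ × ℤ) (hm : b.1 - a.1 = m) (hn : a.2 - b.2 = n)
    (Q : (ZMod (m + n) → ℤ) → Prop) [DecidablePred Q] :
    {γ | γ ∈ PS (m + n) a b ∧ Q (Psi m n b γ)}.ncard = ((WF m n).filter Q).card := by
  rw [← Set.ncard_coe_finset]
  have hinj : Set.InjOn (Psi m n b) {γ | γ ∈ PS (m + n) a b ∧ Q (Psi m n b γ)} :=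
    (Psi_inj m n a b hm hn).mono (fun γ h => h.1)
  rw [← Set.InjOn.ncard_image hinj]
  congr 1
  ext h
  simp only [Finset.coe_filter, mem_WF]
  constructor
  · rintro ⟨γ, ⟨h1, h2⟩, rfl⟩
    exact ⟨Psi_mem m n a b hm hn γ h1, h2⟩
  · rintro ⟨h1, h2⟩
    obtain ⟨γ, hγ, rfl⟩ := Psi_surj m n a b hm hn h h1
    exact ⟨γ, ⟨hγ, h2⟩, rfl⟩

def half (m n : ℕ) (lam τ : ℝ) (h : ZMod (m + n) → ℤ) : Prop :=
  ∃ k : ℕ, k ≤ (m + n) / 2 ∧ τ ≤ lam * (h (k : ZMod (m + n)) : ℝ)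

open Classical in
lemma half_tail (m n : ℕ) [NeZero (m + n)] (lam τ : ℝ) (hτ : 0 ≤ τ) :
    (((WF m n).filter (half m n lam τ)).card : ℝ) ≤
      Real.exp (2 * lam ^ 2 * (m + n) - τ / (m + n)) * ((WF m n).card : ℝ) := by
  have hm : ((m : ℤ), (0 : ℤ)).1 - ((0 : ℤ), (n : ℤ)).1 = m := by simp
  have hn : ((0 : ℤ), (n : ℤ)).2 - ((m : ℤ), (0 : ℤ)).2 = n := by simp
  have hN0 : 0 < m + n := Nat.pos_of_ne_zero (NeZero.ne (m + n))
  set a : ℤ × ℤ := (0, n)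
  set b : ℤ × ℤ := (m, 0)
  have c1 := card_transfer m n a b hm hn (half m n lam τ)
  have c2 := card_transfer m n a b hm hn (fun _ => True)
  simp only [and_true, Finset.filter_true] at c2
  have hmax := maximal m n b lam (τ / (m + n)) (m + n - (m + n) / 2) (by omega) ((m + n) / 2)
    (m + n) a (by omega) (by rw [hm, hn]; push_cast; rfl)
  have hZ : Z (m + n) a b = ((WF m n).card : ℝ) := by
    unfold Z; rw [← c2]; rfl
  rw [hZ] at hmax
  rw [← c1]
  have hNpos : (0 : ℝ) < m + n := by exact_mod_cast hN0
  have hsub : {γ | γ ∈ PS (m + n) a b ∧ half m n lam τ (Psi m n b γ)} ⊆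
      {γ | γ ∈ PS (m + n) a b ∧ ∃ j ≤ (m + n) / 2,
        τ / (m + n) ≤ lam * H m n b (γ j) / (((m + n : ℕ) : ℝ) - j)} := by
    rintro γ ⟨hγ, k, hk, hh⟩
    rw [Psi_nat m n a b hm hn γ hγ k (by omega)] at hh
    refine ⟨hγ, k, hk, ?_⟩
    have hkN : (k : ℝ) < m + n := by exact_mod_cast (by omega : k < m + n)
    have hk0 : (0 : ℝ) ≤ k := by positivity
    push_cast
    exact div_le_div₀ (hτ.trans hh) hh (by linarith) (by linarith)
  have hle := Set.ncard_le_ncard hsub ((PS_finite _ _ _).subset (fun γ h => h.1))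
  refine ((Nat.cast_le (α := ℝ)).2 hle).trans (hmax.trans ?_)
  have hHa : H m n b a = 0 := by simp [H, a, b]; ring
  rw [hHa]
  gcongr
  have hr : (((m + n) / 2 : ℕ) : ℝ) ≤ ((m + n - (m + n) / 2 : ℕ) : ℝ) := by
    exact_mod_cast (by omega)
  have hr2 : ((m : ℝ) + n) ≤ 2 * ((m + n - (m + n) / 2 : ℕ) : ℝ) := by
    exact_mod_cast (by omega : m + n ≤ 2 * (m + n - (m + n) / 2))
  set J : ℝ := (((m + n) / 2 : ℕ) : ℝ)
  set r0 : ℝ := ((m + n - (m + n) / 2 : ℕ) : ℝ)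
  have hr0 : 0 < r0 := by linarith
  have hJ0 : 0 ≤ J := by positivity
  have : lam ^ 2 * ((m : ℝ) + n) ^ 2 * J / r0 ^ 2 ≤ 2 * lam ^ 2 * (m + n) := by
    rw [div_le_iff₀ (by positivity)]
    have h1 : ((m : ℝ) + n) * J ≤ 2 * r0 * r0 := mul_le_mul hr2 hr hJ0 (by positivity)
    have h2 : 0 ≤ lam ^ 2 * ((m : ℝ) + n) := by positivity
    nlinarith [mul_le_mul_of_nonneg_left h1 h2]
  simp only [Int.cast_zero, mul_zero, zero_div]
  linarith

def rev {N : ℕ} (h : ZMod N → ℤ) : ZMod N → ℤ := fun i => - h (-i)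

lemma rev_rev {N : ℕ} (h : ZMod N → ℤ) : rev (rev h) = h := by
  funext i; simp [rev]

lemma rev_mem (m n : ℕ) (h : ZMod (m + n) → ℤ) (hh : h ∈ W m n) : rev h ∈ W m n := by
  refine ⟨by simp [rev, hh.1], fun i => ?_⟩
  have := hh.2 (-(i + 1))
  rw [show -(i + 1) + 1 = -i by ring] at this
  simp only [rev]
  omega

open Classical in
lemma card_rev (m n : ℕ) [NeZero (m + n)] (P : (ZMod (m + n) → ℤ) → Prop) :
    ((WF m n).filter (fun h => P (rev h))).card = ((WF m n).filter P).card := by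
  refine Finset.card_bij' (fun h _ => rev h) (fun h _ => rev h) ?_ ?_ ?_ ?_
  · intro h hh
    simp only [Finset.mem_filter, mem_WF] at hh ⊢
    exact ⟨rev_mem m n h hh.1, hh.2⟩
  · intro h hh
    simp only [Finset.mem_filter, mem_WF] at hh ⊢
    exact ⟨rev_mem m n h hh.1, by rw [rev_rev]; exact hh.2⟩
  · intro h _; exact rev_rev h
  · intro h _; exact rev_rev h

open Classical in
lemma bridge_tail (m n : ℕ) [NeZero (m + n)] (mu T : ℝ) (hmu : 0 ≤ mu) (hT : 0 ≤ T) :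
    (((WF m n).filter (Bad T)).card : ℝ) ≤
      4 * Real.exp (2 * mu ^ 2 * (m + n) - mu * (T / 2) / (m + n)) * ((WF m n).card : ℝ) := by
  have t1 := half_tail m n mu (mu * (T / 2)) (by positivity)
  have t2 := half_tail m n (-mu) (mu * (T / 2)) (by positivity)
  have t3 := card_rev m n (half m n mu (mu * (T / 2)))
  have t4 := card_rev m n (half m n (-mu) (mu * (T / 2)))
  rw [neg_sq] at t2
  have hsub : (WF m n).filter (Bad T) ⊆
      (((WF m n).filter (half m n mu (mu * (T / 2)))) ∪
        ((WF m n).filter (half m n (-mu) (mu * (T / 2))))) ∪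
      (((WF m n).filter (fun h => half m n mu (mu * (T / 2)) (rev h))) ∪
        ((WF m n).filter (fun h => half m n (-mu) (mu * (T / 2)) (rev h)))) := by
    intro h hh
    simp only [Finset.mem_union, Finset.mem_filter] at hh ⊢
    obtain ⟨hW, i0, j0, hij⟩ := hh
    have hex : ∃ i, T / 2 ≤ (h i : ℝ) ∨ T / 2 ≤ -(h i : ℝ) := by
      push_cast at hij
      by_contra hcon
      push Not at hcon
      have h1 := (hcon i0).1
      have h2 := (hcon j0).2
      linarith
    obtain ⟨i, hi⟩ := hex
    have hvl : i.val < m + n := ZMod.val_lt i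
    by_cases hv : i.val ≤ (m + n) / 2
    · rcases hi with hi | hi
      · refine Or.inl (Or.inl ⟨hW, i.val, hv, ?_⟩)
        rw [ZMod.natCast_zmod_val]
        exact mul_le_mul_of_nonneg_left hi hmu
      · refine Or.inl (Or.inr ⟨hW, i.val, hv, ?_⟩)
        rw [ZMod.natCast_zmod_val]
        have := mul_le_mul_of_nonneg_left hi hmu
        linarith
    · have hv' : (-i).val ≤ (m + n) / 2 := by
        rw [ZMod.neg_val]
        split_ifs
        · omega
        · omega
      rcases hi with hi | hi
      · refine Or.inr (Or.inr ⟨hW, (-i).val, hv', ?_⟩)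
        rw [ZMod.natCast_zmod_val, rev, neg_neg]
        have := mul_le_mul_of_nonneg_left hi hmu
        push_cast
        linarith
      · refine Or.inr (Or.inl ⟨hW, (-i).val, hv', ?_⟩)
        rw [ZMod.natCast_zmod_val, rev, neg_neg]
        have := mul_le_mul_of_nonneg_left hi hmu
        push_cast
        linarith
  have hc := (Finset.card_le_card hsub).trans ((Finset.card_union_le _ _).trans
    (add_le_add (Finset.card_union_le _ _) (Finset.card_union_le _ _)))
  rw [t3, t4] at hc
  have hc' := (Nat.cast_le (α := ℝ)).2 hc
  push_cast at hc'
  linarith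

open Classical in
lemma exc_tail (m n : ℕ) [NeZero (m + n)] (mu T : ℝ) (hmu : 0 ≤ mu) (hT : 0 ≤ T) :
    (((EF m n).filter (Bad T)).card : ℝ) ≤
      4 * Real.exp (2 * mu ^ 2 * (m + n) - mu * (T / 2) / (m + n)) * ((EF m n).card : ℝ) := by
  have h1 := compare m n T
  have h2 := bridge_tail m n mu T hmu hT
  rcases Nat.eq_zero_or_pos (WF m n).card with h | h
  · have : (EF m n).filter (Bad T) = ∅ := by
      rw [Finset.card_eq_zero] at h
      simp [EF, h]
    rw [this]
    simp only [Finset.card_empty, Nat.cast_zero]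
    positivity
  · have hp : (0 : ℝ) < (WF m n).card := by exact_mod_cast h
    have h3 : (0 : ℝ) ≤ (EF m n).card := by positivity
    refine le_of_mul_le_mul_right ?_ hp
    calc _ ≤ _ := h1
      _ ≤ _ := mul_le_mul_of_nonneg_right h2 h3
      _ = _ := by ring

lemma exponent (m n : ℕ) (hN : 0 < m + n) (t : ℝ) (ht : 0 ≤ t) :
    2 * (t / (16 * √((m : ℝ) + n))) ^ 2 * (m + n) -
      (t / (16 * √((m : ℝ) + n))) * ((t * (√(√((m : ℝ) ^ 2 + n ^ 2)) * √((m : ℝ) ^ 2 + n ^ 2))) / 2)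
        / (m + n) ≤ -(1 / 128) * t ^ 2 := by
  have hNR : (0 : ℝ) < m + n := by exact_mod_cast hN
  have hs : √((m : ℝ) + n) ^ 2 = m + n := Real.sq_sqrt hNR.le
  have hs0 : 0 < √((m : ℝ) + n) := Real.sqrt_pos.2 hNR
  have hL : √((m : ℝ) ^ 2 + n ^ 2) ^ 2 = (m : ℝ) ^ 2 + n ^ 2 := Real.sq_sqrt (by positivity)
  have hw : √(√((m : ℝ) ^ 2 + n ^ 2)) ^ 2 = √((m : ℝ) ^ 2 + n ^ 2) :=
    Real.sq_sqrt (Real.sqrt_nonneg _)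
  have hw0 : 0 ≤ √(√((m : ℝ) ^ 2 + n ^ 2)) := Real.sqrt_nonneg _
  rw [← hw] at hL
  rw [← hw, Real.sqrt_sq hw0]
  set s := √((m : ℝ) + n)
  set w := √(√((m : ℝ) ^ 2 + n ^ 2))
  have h1 : (4 / 5 * s) ^ 4 ≤ w ^ 4 := by
    have e : w ^ 4 = (m : ℝ) ^ 2 + n ^ 2 := by rw [← hL]; ring
    have e2 : (4 / 5 * s) ^ 4 = 256 / 625 * (m + n) ^ 2 := by rw [← hs]; ring
    rw [e, e2]
    nlinarith [sq_nonneg ((m : ℝ) - n), sq_nonneg ((m : ℝ)), sq_nonneg (n : ℝ)]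
  have h2 : 4 / 5 * s ≤ w := le_of_pow_le_pow_left₀ (by norm_num) hw0 h1
  have h3 : (4 / 5 * s) ^ 3 ≤ w ^ 3 := pow_le_pow_left₀ (by positivity) h2 3
  have h4 : s ^ 3 / 2 ≤ w ^ 3 := by
    have : 0 < s ^ 3 := by positivity
    nlinarith
  rw [← hs]
  have e1 : 2 * (t / (16 * s)) ^ 2 * s ^ 2 = t ^ 2 / 128 := by field_simp; ring
  have e2 : t / (16 * s) * (t * (w * w ^ 2) / 2) / s ^ 2 = t ^ 2 / 32 * (w ^ 3 / s ^ 3) := by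
    field_simp; ring
  have h5 : 1 / 2 ≤ w ^ 3 / s ^ 3 := by
    rw [le_div_iff₀ (by positivity)]; linarith
  rw [e1, e2]
  nlinarith [mul_le_mul_of_nonneg_left h5 (by positivity : 0 ≤ t ^ 2 / 32)]

lemma eDist_le (m n : ℕ) (hN : 0 < m + n) (a b p : ℤ × ℤ) (hm : b.1 - a.1 = m) (hn : a.2 - b.2 = n)
    (h1 : a.1 ≤ p.1) (h2 : p.1 ≤ b.1) (h3 : b.2 ≤ p.2) (h4 : p.2 ≤ a.2) :
    eDist (emb p) (segment ℝ (emb a) (emb b)) ≤ |(H m n b p : ℝ)| / √((m : ℝ) ^ 2 + n ^ 2) := by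
  have hmR : (b.1 : ℝ) = a.1 + m := by
    have : (b.1 : ℤ) = a.1 + m := by linarith
    exact_mod_cast this
  have hnR : (b.2 : ℝ) = a.2 - n := by
    have : (b.2 : ℤ) = a.2 - n := by linarith
    rw [this]; push_cast; ring
  obtain ⟨x, hx⟩ : ∃ x : ℝ, x = p.1 - a.1 := ⟨_, rfl⟩
  obtain ⟨y, hy⟩ : ∃ y : ℝ, y = a.2 - p.2 := ⟨_, rfl⟩
  have h1' : (a.1 : ℝ) ≤ p.1 := by exact_mod_cast h1
  have h2' : (p.1 : ℝ) ≤ b.1 := by exact_mod_cast h2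
  have h3' : (b.2 : ℝ) ≤ p.2 := by exact_mod_cast h3
  have h4' : (p.2 : ℝ) ≤ a.2 := by exact_mod_cast h4
  have x0 : 0 ≤ x := by linarith
  have xm : x ≤ m := by linarith
  have y0 : 0 ≤ y := by linarith
  have yn : y ≤ n := by linarith
  have hm0 : (0 : ℝ) ≤ m := by positivity
  have hn0 : (0 : ℝ) ≤ n := by positivity
  have hD : (0 : ℝ) < (m : ℝ) ^ 2 + n ^ 2 := by
    have : (0 : ℝ) < m + n := by exact_mod_cast hN
    nlinarith [sq_nonneg ((m : ℝ) - n)]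
  set D : ℝ := (m : ℝ) ^ 2 + n ^ 2 with hDdef
  set s : ℝ := (x * m + y * n) / D with hs
  have s0 : 0 ≤ s := by positivity
  have s1 : s ≤ 1 := by
    rw [hs, div_le_one hD]; nlinarith
  have hHR : (H m n b p : ℝ) = n * x - m * y := by
    simp only [H]; push_cast
    rw [hmR, hnR, hx, hy]; ring
  have hmem : ((a.1 : ℝ) + s * m, (a.2 : ℝ) - s * n) ∈ segment ℝ (emb a) (emb b) := by
    refine ⟨1 - s, s, by linarith, s0, by ring, ?_⟩
    simp only [emb, hmR, hnR]
    ext <;> simp <;> ring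
  unfold eDist
  refine (csInf_le ⟨0, ?_⟩ (Set.mem_image_of_mem _ hmem)).trans (le_of_eq ?_)
  · rintro _ ⟨q, _, rfl⟩
    exact Real.sqrt_nonneg _
  · simp only [emb]
    have e : ((p.1 : ℝ) - (a.1 + s * m)) ^ 2 + ((p.2 : ℝ) - (a.2 - s * n)) ^ 2
        = (H m n b p : ℝ) ^ 2 / D := by
      rw [hHR, show (p.1 : ℝ) = a.1 + x by rw [hx]; ring, show (p.2 : ℝ) = a.2 - y by rw [hy]; ring,
        hs]
      field_simp
      rw [hDdef]; ring
    rw [e, Real.sqrt_div (sq_nonneg _), Real.sqrt_sq_eq_abs]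

end GT

theorem stmt15 :
    ∃ c C N₀ : ℝ, 0 < c ∧ 0 < C ∧ 0 < N₀ ∧
      ∀ a b : ℤ × ℤ, 0 ≤ a.1 → 0 ≤ b.2 → a.1 ≤ b.1 → b.2 ≤ a.2 →
        a.1 * b.2 < b.1 * a.2 →
        N₀ ≤ Real.sqrt (((b.1 - a.1 : ℤ) : ℝ) ^ 2 + ((a.2 - b.2 : ℤ) : ℝ) ^ 2) →
        ∀ t : ℝ, 0 ≤ t →
          (Nat.card {γ : ℕ → ℤ × ℤ //
              IsPathBtw ((b.1 - a.1) + (a.2 - b.2)).toNat a b γ ∧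
              (∀ k, belowSeg a b (γ k)) ∧
              ∃ k, k ≤ ((b.1 - a.1) + (a.2 - b.2)).toNat ∧
                t * Real.sqrt (Real.sqrt (((b.1 - a.1 : ℤ) : ℝ) ^ 2 +
                    ((a.2 - b.2 : ℤ) : ℝ) ^ 2))
                  ≤ eDist (emb (γ k)) (segment ℝ (emb a) (emb b))} : ℝ)
            ≤ C * Real.exp (-c * t ^ 2) *
              (Nat.card {γ : ℕ → ℤ × ℤ //
                IsPathBtw ((b.1 - a.1) + (a.2 - b.2)).toNat a b γ ∧
                ∀ k, belowSeg a b (γ k)} : ℝ) := by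
  classical
  refine ⟨1 / 128, 4, 1, by norm_num, by norm_num, by norm_num, ?_⟩
  intro a b ha hb hab1 hab2 _ hN0 t ht
  obtain ⟨m, hm⟩ := Int.eq_ofNat_of_zero_le (sub_nonneg.2 hab1)
  obtain ⟨n, hn⟩ := Int.eq_ofNat_of_zero_le (sub_nonneg.2 hab2)
  rw [hm, hn] at hN0 ⊢
  have htn : ((m : ℤ) + n).toNat = m + n := by omega
  rw [htn]
  simp only [Int.cast_natCast] at hN0 ⊢
  have hN : 0 < m + n := by
    rcases Nat.eq_zero_or_pos (m + n) with h | h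
    · obtain ⟨rfl, rfl⟩ : m = 0 ∧ n = 0 := by omega
      norm_num at hN0
    · exact h
  have : NeZero (m + n) := ⟨hN.ne'⟩
  have hNR : (0 : ℝ) < m + n := by exact_mod_cast hN
  have hL0 : 0 < √((m : ℝ) ^ 2 + n ^ 2) := by linarith
  have hbelow : ∀ p, belowSeg a b p ↔ GT.H m n b p ≤ 0 := by
    intro p
    unfold belowSeg GT.H
    rw [hm, show b.2 - a.2 = -n by linarith]
    have e : (n : ℤ) * (p.1 - b.1) + m * (p.2 - b.2) = n * (p.1 - a.1) + m * (p.2 - a.2) := by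
      linear_combination (-(n : ℤ)) * hm + m * hn
    rw [e]
    constructor <;> intro h <;> linarith
  -- nonpositivity transfers
  have hneg : ∀ γ ∈ GT.PS (m + n) a b, (∀ k, belowSeg a b (γ k)) ↔ ∀ i, GT.Psi m n b γ i ≤ 0 := by
    intro γ hγ
    constructor
    · intro h i
      exact (hbelow _).1 (h i.val)
    · intro h k
      rw [hbelow]
      rcases le_total k (m + n) with hk | hk
      · rw [← GT.Psi_nat m n a b hm hn γ hγ k hk]; exact h _
      · rw [hγ.1.2 k hk, ← GT.Psi_nat m n a b hm hn γ hγ (m + n) le_rfl]; exact h _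
  set T : ℝ := t * (√(√((m : ℝ) ^ 2 + n ^ 2)) * √((m : ℝ) ^ 2 + n ^ 2)) with hT
  have hT0 : 0 ≤ T := by positivity
  have main := GT.exc_tail m n (t / (16 * √((m : ℝ) + n))) T (by positivity) hT0
  have hex := GT.exponent m n hN t ht
  have c1 : (Nat.card {γ : ℕ → ℤ × ℤ // IsPathBtw (m + n) a b γ ∧ ∀ k, belowSeg a b (γ k)})
      = (GT.EF m n).card := by
    rw [GT.card_sub, GT.EF, ← GT.card_transfer m n a b hm hn]
    congr 1
    ext γ
    exact and_congr_right (fun hγ => hneg γ hγ)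
  have c2 : (Nat.card {γ : ℕ → ℤ × ℤ // IsPathBtw (m + n) a b γ ∧ (∀ k, belowSeg a b (γ k)) ∧
      ∃ k, k ≤ m + n ∧ t * √(√((m : ℝ) ^ 2 + n ^ 2)) ≤
        eDist (emb (γ k)) (segment ℝ (emb a) (emb b))})
      ≤ ((GT.EF m n).filter (GT.Bad T)).card := by
    rw [GT.card_sub, GT.EF, Finset.filter_filter, ← GT.card_transfer m n a b hm hn]
    refine Set.ncard_le_ncard ?_ ((GT.PS_finite (m + n) a b).subset (fun γ h => h.1))
    rintro γ ⟨hγ, hb, k, hk, hd⟩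
    refine ⟨hγ, (hneg γ hγ).1 hb, 0, k, ?_⟩
    have hp := GT.path_pos _ _ _ _ hγ k hk
    have hq := GT.path_pos' _ _ _ _ hγ k (m + n - k) (by omega)
    rw [Nat.add_sub_cancel' hk, hγ.2.2] at hq
    have hd2 := hd.trans (GT.eDist_le m n hN a b (γ k) hm hn hp.1 hq.1 hq.2 hp.2.1)
    rw [le_div_iff₀ hL0] at hd2
    rw [(GT.Psi_mem m n a b hm hn γ hγ).1, GT.Psi_nat m n a b hm hn γ hγ k hk]
    have hH : (GT.H m n b (γ k) : ℝ) ≤ 0 := by exact_mod_cast (hbelow _).1 (hb k)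
    rw [abs_of_nonpos hH] at hd2
    push_cast
    rw [hT]
    linarith
  rw [c1]
  refine ((Nat.cast_le (α := ℝ)).2 c2).trans (main.trans ?_)
  have h0 : (0 : ℝ) ≤ (GT.EF m n).card := by positivity
  gcongr
end

section
/- Uniform positive probability of good area capture for the simple random walk bridge: For every ε, η > 0 there exist c = c(ε, η) > 0 and N₀ = N₀(ε, η) such that the following holds. Let x, y ∈ ℕ² admit at least one down-right path from x to y, with the angle θ(x,y) between [x,y] and the horizontal lying in [ε, π/2 − ε] and with h := ‖x − y‖ ≥ N₀. Let P_{x,y} be the uniform measure on down-right paths from x to y. Then P_{x,y}[ |Enclose(γ ∩ A_{x,y})| − |T_{0,x,y}| ≥ η·h^{3/2} ] ≥ c, where A_{x,y} is the cone at the origin bounded by the rays through x and y, Enclose(γ ∩ A_{x,y}) is the region bounded by γ and the two rays, and T_{0,x,y} is the triangle with vertices 0, x, y. -/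
def cross (p q : ℤ × ℤ) : ℤ := p.1 * q.2 - p.2 * q.1

/-- Twice the excess area `|Enclose(γ ∩ A_{x,y})| − |T_{0,x,y}|` of a down-right path
from `x = γ 0` to `y = γ m`, computed by the shoelace formula. -/
def excessArea2 (m : ℕ) (γ : ℕ → ℤ × ℤ) : ℤ :=
  cross (γ 0) (γ m) - ∑ k ∈ Finset.range m, cross (γ k) (γ (k + 1))


/-- The weights of the midpoint distribution. -/
noncomputable def wgt (n a m j : ℕ) : ℝ := (m.choose j : ℝ) * ((n - m).choose (a - j) : ℝ)

lemma wgt_nonneg (n a m j : ℕ) : 0 ≤ wgt n a m j := by unfold wgt; positivity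

lemma wgt_balance (n a m j : ℕ) (hm : m ≤ n) (hj : j < a) :
    wgt n a m (j + 1) * (((j : ℝ) + 1) * ((n : ℝ) - m - a + j + 1))
      = wgt n a m j * (((m : ℝ) - j) * ((a : ℝ) - j)) := by
  have h1 : (m.choose (j + 1) : ℝ) * ((j : ℝ) + 1) = m.choose j * ((m : ℝ) - j) := by
    rcases le_or_gt j m with h | h
    · have := Nat.choose_succ_right_eq m j
      have h2 : ((m.choose (j + 1) * (j + 1) : ℕ) : ℝ) = ((m.choose j * (m - j) : ℕ) : ℝ) := by
        rw [this]
      push_cast [Nat.cast_sub h] at h2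
      exact h2
    · rw [Nat.choose_eq_zero_of_lt h, Nat.choose_eq_zero_of_lt (by omega)]; simp
  have h2 : ((n - m).choose (a - j) : ℝ) * ((a : ℝ) - j)
      = (n - m).choose (a - (j + 1)) * ((n : ℝ) - m - a + j + 1) := by
    obtain ⟨d, rfl⟩ : ∃ d, a = j + 1 + d := ⟨a - (j + 1), by omega⟩
    obtain ⟨r, rfl⟩ : ∃ r, n = m + r := ⟨n - m, by omega⟩
    have e1 : j + 1 + d - j = d + 1 := by omega
    have e2 : j + 1 + d - (j + 1) = d := by omega
    have e3 : m + r - m = r := by omega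
    rw [e1, e2, e3]
    rcases le_or_gt d r with h | h
    · have := Nat.choose_succ_right_eq r d
      have h2 : ((r.choose (d + 1) * (d + 1) : ℕ) : ℝ) = ((r.choose d * (r - d) : ℕ) : ℝ) := by
        rw [this]
      push_cast [Nat.cast_sub h] at h2 ⊢
      linear_combination h2
    · rw [Nat.choose_eq_zero_of_lt h, Nat.choose_eq_zero_of_lt (by omega)]; simp
  unfold wgt
  linear_combination ((n - m).choose (a - (j + 1)) : ℝ) * ((n : ℝ) - m - a + j + 1) * h1
    - (m.choose j : ℝ) * ((m : ℝ) - j) * h2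

lemma wgt_sum (n a m : ℕ) (hm : m ≤ n) :
    ∑ j ∈ Finset.range (a + 1), wgt n a m j = (n.choose a : ℝ) := by
  have h := Nat.add_choose_eq m (n - m) a
  rw [Nat.add_sub_cancel' hm, Finset.Nat.sum_antidiagonal_eq_sum_range_succ_mk] at h
  rw [h]; push_cast; rfl

lemma wgt_var (n a m : ℕ) (hn : 0 < n) (hm : m ≤ n) (ha : a ≤ n) :
    ∑ j ∈ Finset.range (a + 1), wgt n a m j * ((j : ℝ) - a * m / n) ^ 2
      ≤ n * ∑ j ∈ Finset.range (a + 1), wgt n a m j := by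
  have hn' : (0 : ℝ) < n := by exact_mod_cast hn
  set μ : ℝ := (a : ℝ) * m / n with hμ
  have hμn : μ * n = a * m := by rw [hμ]; field_simp
  set F : ℕ → ℝ := fun j => wgt n a m j * ((j : ℝ) * ((n : ℝ) - m - a + j)) * (j - μ) with hF
  set G : ℕ → ℝ := fun j => wgt n a m j * (((m : ℝ) - j) * ((a : ℝ) - j)) * (j + 1 - μ) with hG
  have hFG : ∑ j ∈ Finset.range (a + 1), G j = ∑ j ∈ Finset.range (a + 1), F j := by
    rw [Finset.sum_range_succ, Finset.sum_range_succ']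
    have h1 : G a = 0 := by simp [hG]
    have h2 : F 0 = 0 := by simp [hF]
    rw [h1, h2]
    congr 1
    apply Finset.sum_congr rfl
    intro j hj
    have := wgt_balance n a m j hm (Finset.mem_range.1 hj)
    simp only [hF, hG]
    rw [← this]; push_cast; ring
  have key : n * ∑ j ∈ Finset.range (a + 1), wgt n a m j * ((j : ℝ) - μ) ^ 2
      = ∑ j ∈ Finset.range (a + 1), wgt n a m j * (((m : ℝ) - j) * ((a : ℝ) - j)) := by
    rw [Finset.mul_sum, ← sub_eq_zero, ← Finset.sum_sub_distrib, ← neg_eq_zero,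
      ← Finset.sum_neg_distrib]
    rw [← sub_eq_zero, ← Finset.sum_sub_distrib] at hFG
    rw [← hFG]
    apply Finset.sum_congr rfl
    intro j _
    simp only [hF, hG]
    linear_combination (wgt n a m j * (j - μ)) * hμn
  have hle : ∑ j ∈ Finset.range (a + 1), wgt n a m j * (((m : ℝ) - j) * ((a : ℝ) - j))
      ≤ n * (n * ∑ j ∈ Finset.range (a + 1), wgt n a m j) := by
    rw [Finset.mul_sum, Finset.mul_sum]
    apply Finset.sum_le_sum
    intro j hj
    have hja : (j : ℝ) ≤ a := by
      have := Finset.mem_range.1 hj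
      exact_mod_cast (by omega : j ≤ a)
    rcases le_or_gt j m with h | h
    · have hjm : (j : ℝ) ≤ m := by exact_mod_cast h
      have hmn : (m : ℝ) ≤ n := by exact_mod_cast hm
      have han : (a : ℝ) ≤ n := by exact_mod_cast ha
      have hj0 : (0 : ℝ) ≤ j := by positivity
      have : ((m : ℝ) - j) * ((a : ℝ) - j) ≤ n * n := by
        apply mul_le_mul <;> linarith
      have := mul_le_mul_of_nonneg_left this (wgt_nonneg n a m j)
      linarith
    · have : wgt n a m j = 0 := by
        unfold wgt; rw [Nat.choose_eq_zero_of_lt h]; simp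
      simp [this]
  rw [← key] at hle
  exact le_of_mul_le_mul_left hle hn'

lemma wgt_window (n a m : ℕ) (hn : 0 < n) (hm : m ≤ n) (ha : a ≤ n) :
    (n.choose a : ℝ) ≤ 2 * ∑ j ∈ (Finset.range (a + 1)).filter
      (fun j : ℕ => |(j : ℝ) - a * m / n| ≤ 2 * Real.sqrt n), wgt n a m j := by
  have hn' : (0 : ℝ) < n := by exact_mod_cast hn
  have hv := wgt_var n a m hn hm ha
  have hs := wgt_sum n a m hm
  set μ : ℝ := (a : ℝ) * m / n with hμ
  have hsplit := Finset.sum_filter_add_sum_filter_not (Finset.range (a + 1))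
    (fun j : ℕ => |(j : ℝ) - μ| ≤ 2 * Real.sqrt n) (fun j => wgt n a m j)
  have h1 : 4 * n * ∑ j ∈ (Finset.range (a + 1)).filter
      (fun j : ℕ => ¬ |(j : ℝ) - μ| ≤ 2 * Real.sqrt n), wgt n a m j
      ≤ ∑ j ∈ Finset.range (a + 1), wgt n a m j * ((j : ℝ) - μ) ^ 2 := by
    rw [Finset.mul_sum]
    refine le_trans ?_ (Finset.sum_le_sum_of_subset_of_nonneg (Finset.filter_subset
      (fun j : ℕ => ¬ |(j : ℝ) - μ| ≤ 2 * Real.sqrt n) _) ?_)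
    · apply Finset.sum_le_sum
      intro j hj
      have hj2 := (Finset.mem_filter.1 hj).2
      push Not at hj2
      have h4 : 4 * (n : ℝ) ≤ ((j : ℝ) - μ) ^ 2 := by
        rw [← sq_abs]
        have := Real.sq_sqrt hn'.le
        nlinarith [Real.sqrt_nonneg (n : ℝ)]
      have := mul_le_mul_of_nonneg_left h4 (wgt_nonneg n a m j)
      linarith
    · intro j _ _
      exact mul_nonneg (wgt_nonneg n a m j) (sq_nonneg _)
  rw [hs] at hv hsplit
  have h2 : 4 * ∑ j ∈ (Finset.range (a + 1)).filter
      (fun j : ℕ => ¬ |(j : ℝ) - μ| ≤ 2 * Real.sqrt n), wgt n a m j ≤ (n.choose a : ℝ) := by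
    have : (n : ℝ) * (4 * ∑ j ∈ (Finset.range (a + 1)).filter
      (fun j : ℕ => ¬ |(j : ℝ) - μ| ≤ 2 * Real.sqrt n), wgt n a m j) ≤ n * (n.choose a : ℝ) := by
      linarith
    exact le_of_mul_le_mul_left this hn'
  have : (0 : ℝ) ≤ n.choose a := by positivity
  linarith

lemma wgt_step (κ L : ℝ) (hκ : 0 < κ) (hL : 0 < L) (n a m i : ℕ) (ha : a ≤ n)
    (hm3 : n ≤ 3 * m) (hm2 : 2 * m ≤ n) (hκa : κ * n ≤ 2 * a) (hκb : κ * n ≤ 2 * ((n : ℝ) - a))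
    (hn : 1 ≤ n) (hbig : 12 * L ≤ κ * Real.sqrt n)
    (hi : |(i : ℝ) - a * m / n| ≤ L * Real.sqrt n) :
    i < a ∧ wgt n a m i ≤ Real.exp (144 * (L + 2) / κ ^ 2 / Real.sqrt n) * wgt n a m (i + 1) := by
  have hn' : (1 : ℝ) ≤ n := by exact_mod_cast hn
  set q := Real.sqrt n with hq
  have hqq : q * q = n := Real.mul_self_sqrt (by linarith)
  have hq1 : 1 ≤ q := by rw [hq]; exact Real.one_le_sqrt.2 hn'
  have hm3' : (n : ℝ) ≤ 3 * m := by exact_mod_cast hm3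
  have hm2' : 2 * (m : ℝ) ≤ n := by exact_mod_cast hm2
  have ha' : (a : ℝ) ≤ n := by exact_mod_cast ha
  set μ : ℝ := (a : ℝ) * m / n with hμ
  have hμn : μ * n = a * m := by rw [hμ]; field_simp
  obtain ⟨t1, t2⟩ := abs_le.1 hi
  have hLq : 12 * (L * q) ≤ κ * n := by
    rw [← hqq]; nlinarith
  have hmμ : κ * n / 6 ≤ m - μ := by
    have : (κ * n / 6) * n ≤ (m - μ) * n := by
      have : (m - μ) * n = m * (n - a) := by linear_combination -hμn
      rw [this]
      nlinarith
    exact le_of_mul_le_mul_right this (by linarith)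
  have haμ : κ * n / 6 ≤ a - μ := by
    have : (κ * n / 6) * n ≤ (a - μ) * n := by
      have : (a - μ) * n = a * (n - m) := by linear_combination -hμn
      rw [this]
      nlinarith
    exact le_of_mul_le_mul_right this (by linarith)
  have hA : κ * n / 12 ≤ m - i := by linarith
  have hB : κ * n / 12 ≤ a - i := by linarith
  have hpos : 0 < κ * n / 12 := by positivity
  have hia : i < a := by
    have : (i : ℝ) < a := by linarith
    exact_mod_cast this
  refine ⟨hia, ?_⟩
  have hbal := wgt_balance n a m i (by omega) hia
  set num : ℝ := ((m : ℝ) - i) * ((a : ℝ) - i) with hnum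
  set den : ℝ := ((i : ℝ) + 1) * ((n : ℝ) - m - a + i + 1) with hden
  have hnumpos : 0 < num := mul_pos (by linarith) (by linarith)
  have hnumge : (κ * n / 12) * (κ * n / 12) ≤ num := mul_le_mul hA hB hpos.le (by linarith)
  have hdiff : den - num ≤ (L + 2) * (n * q) := by
    have e : den - num = n * (i - μ) + (n - m - a + 2 * i + 1) := by
      rw [hden, hnum]; linear_combination hμn
    rw [e]
    have : (n : ℝ) * (i - μ) ≤ n * (L * q) := mul_le_mul_of_nonneg_left t2 (by linarith)
    have : (n : ℝ) * 1 ≤ n * q := mul_le_mul_of_nonneg_left hq1 (by linarith)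
    nlinarith
  have hC : (L + 2) * (n * q) ≤ (144 * (L + 2) / κ ^ 2 / q) * num := by
    have e : (L + 2) * (n * q) = (144 * (L + 2) / κ ^ 2 / q) * ((κ * n / 12) * (κ * n / 12)) := by
      rw [← hqq]; field_simp; ring
    rw [e]
    exact mul_le_mul_of_nonneg_left hnumge (by positivity)
  have hdn : den ≤ Real.exp (144 * (L + 2) / κ ^ 2 / q) * num := by
    have := Real.add_one_le_exp (144 * (L + 2) / κ ^ 2 / q)
    have := mul_le_mul_of_nonneg_right this hnumpos.le
    linarith
  have hw := wgt_nonneg n a m (i + 1)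
  have : wgt n a m i * num ≤ (Real.exp (144 * (L + 2) / κ ^ 2 / q) * wgt n a m (i + 1)) * num := by
    rw [← hbal]
    have := mul_le_mul_of_nonneg_left hdn hw
    linarith
  exact le_of_mul_le_mul_right this hnumpos

lemma wgt_tail (κ η : ℝ) (hκ : 0 < κ) (hη : 0 < η) (n a m : ℕ) (ha : a ≤ n)
    (hm3 : n ≤ 3 * m) (hm2 : 2 * m ≤ n) (hκa : κ * n ≤ 2 * a) (hκb : κ * n ≤ 2 * ((n : ℝ) - a))
    (hn : 1 ≤ n) (hbig : 12 * (2 * η + 5) ≤ κ * Real.sqrt n) :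
    (n.choose a : ℝ) ≤ 2 * Real.exp (144 * (2 * η + 7) / κ ^ 2 * (2 * η + 3)) *
      ∑ j ∈ (Finset.range (a + 1)).filter
      (fun j : ℕ => 2 * η * (n * Real.sqrt n) ≤ (j : ℝ) * n - a * m), wgt n a m j := by
  have hn' : (1 : ℝ) ≤ n := by exact_mod_cast hn
  have hwin := wgt_window n a m (by omega) (by omega) ha
  have hstep := fun i => wgt_step κ (2 * η + 5) hκ (by linarith) n a m i ha hm3 hm2 hκa hκb hn hbig
  set q := Real.sqrt n with hq
  have hq1 : 1 ≤ q := by rw [hq]; exact Real.one_le_sqrt.2 hn'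
  set μ : ℝ := (a : ℝ) * m / n with hμ
  have hμn : μ * n = a * m := by rw [hμ]; field_simp
  set s : ℕ := ⌈(2 * η + 2) * q⌉₊ with hs
  have hs1 : (2 * η + 2) * q ≤ s := Nat.le_ceil _
  have hs2 : (s : ℝ) ≤ (2 * η + 3) * q := by
    have := Nat.ceil_lt_add_one (show 0 ≤ (2 * η + 2) * q by positivity)
    rw [← hs] at this
    linarith
  set C : ℝ := 144 * (2 * η + 5 + 2) / κ ^ 2 with hC
  have hC0 : 0 ≤ C := by rw [hC]; positivity
  have hCe : 144 * (2 * η + 7) / κ ^ 2 = C := by rw [hC]; congr 2; ring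
  rw [hCe]
  have iter : ∀ j : ℕ, j ≤ a → |(j : ℝ) - μ| ≤ 2 * q → ∀ r : ℕ, r ≤ s →
      j + r ≤ a ∧ wgt n a m j ≤ Real.exp (r * (C / q)) * wgt n a m (j + r) := by
    intro j hja hj r
    obtain ⟨j1, j2⟩ := abs_le.1 hj
    induction r with
    | zero => intro _; simpa using hja
    | succ r ih =>
      intro hr
      obtain ⟨_, i2⟩ := ih (by omega)
      have hrs : (r : ℝ) ≤ s := by exact_mod_cast (by omega : r ≤ s)
      have hr0 : (0 : ℝ) ≤ r := by positivity
      obtain ⟨k1, k2⟩ := hstep (j + r) (by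
        push_cast
        rw [abs_le]; constructor <;> nlinarith)
      refine ⟨by omega, i2.trans ?_⟩
      have := mul_le_mul_of_nonneg_left k2 (Real.exp_nonneg (r * (C / q)))
      rw [← mul_assoc, ← Real.exp_add] at this
      refine this.trans (le_of_eq ?_)
      rw [add_assoc]; congr 2; push_cast; ring
  have hshift : ∑ j ∈ (Finset.range (a + 1)).filter
      (fun j : ℕ => |(j : ℝ) - μ| ≤ 2 * q), wgt n a m j ≤
      Real.exp (C * (2 * η + 3)) * ∑ j ∈ (Finset.range (a + 1)).filter
      (fun j : ℕ => 2 * η * (n * q) ≤ (j : ℝ) * n - a * m), wgt n a m j := by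
    calc _ ≤ ∑ j ∈ (Finset.range (a + 1)).filter
          (fun j : ℕ => |(j : ℝ) - μ| ≤ 2 * q), Real.exp (C * (2 * η + 3)) * wgt n a m (j + s) := by
          apply Finset.sum_le_sum
          intro j hj
          obtain ⟨h1, h2⟩ := Finset.mem_filter.1 hj
          have h1 := Finset.mem_range.1 h1
          refine (iter j (by omega) h2 s le_rfl).2.trans ?_
          apply mul_le_mul_of_nonneg_right _ (wgt_nonneg _ _ _ _)
          apply Real.exp_le_exp.2
          have : (s : ℝ) * (C / q) ≤ (2 * η + 3) * q * (C / q) :=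
            mul_le_mul_of_nonneg_right hs2 (by positivity)
          refine this.trans (le_of_eq ?_)
          field_simp
      _ = Real.exp (C * (2 * η + 3)) * ∑ j ∈ ((Finset.range (a + 1)).filter
          (fun j : ℕ => |(j : ℝ) - μ| ≤ 2 * q)).image (· + s), wgt n a m j := by
          rw [Finset.sum_image (fun x _ y _ h => by simpa using h), Finset.mul_sum]
      _ ≤ _ := by
          apply mul_le_mul_of_nonneg_left _ (Real.exp_nonneg _)
          apply Finset.sum_le_sum_of_subset_of_nonneg
          · intro k hk
            obtain ⟨j, hj, rfl⟩ := Finset.mem_image.1 hk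
            obtain ⟨h1, h2⟩ := Finset.mem_filter.1 hj
            have h1 := Finset.mem_range.1 h1
            have h3 := (iter j (by omega) h2 s le_rfl).1
            rw [Finset.mem_filter, Finset.mem_range]
            refine ⟨by omega, ?_⟩
            have := (abs_le.1 h2).1
            push_cast
            rw [← hμn]
            have : 2 * η * q ≤ j + s - μ := by linarith
            have := mul_le_mul_of_nonneg_right this (show (0 : ℝ) ≤ n by linarith)
            linarith
          · intro _ _ _; exact wgt_nonneg _ _ _ _
  linarith

/-- Twice the excess area in terms of the set of right-steps. -/
def dsum (n : ℕ) (S : Finset ℕ) : ℤ := ∑ k ∈ S, ((n : ℤ) - 1 - 2 * k)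

lemma dsum_reflect (m j : ℕ) :
    ((Finset.range m).powersetCard j).card ≤
      2 * (((Finset.range m).powersetCard j).filter (fun S => 0 ≤ dsum m S)).card := by
  have hsplit := Finset.card_filter_add_card_filter_not (s := (Finset.range m).powersetCard j)
    (fun S => 0 ≤ dsum m S)
  have : (((Finset.range m).powersetCard j).filter (fun S => ¬ 0 ≤ dsum m S)).card ≤
      (((Finset.range m).powersetCard j).filter (fun S => 0 ≤ dsum m S)).card := by
    have inj : ∀ S ⊆ Finset.range m, Set.InjOn (fun k => m - 1 - k) (S : Set ℕ) := by
      intro S hS k hk l hl h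
      have := Finset.mem_range.1 (hS hk)
      have := Finset.mem_range.1 (hS hl)
      simp only at h
      omega
    apply Finset.card_le_card_of_injOn (fun S => S.image (fun k => m - 1 - k))
    · intro S hS
      have hS := Finset.mem_coe.1 hS
      rw [Finset.mem_filter, Finset.mem_powersetCard] at hS
      obtain ⟨⟨h1, h2⟩, h3⟩ := hS
      refine Finset.mem_coe.2 ?_
      rw [Finset.mem_filter, Finset.mem_powersetCard]
      refine ⟨⟨?_, ?_⟩, ?_⟩
      · intro k hk
        obtain ⟨l, hl, rfl⟩ := Finset.mem_image.1 hk
        have := Finset.mem_range.1 (h1 hl)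
        rw [Finset.mem_range]; omega
      · rw [Finset.card_image_of_injOn (inj S h1), h2]
      · have : dsum m (S.image (fun k => m - 1 - k)) = - dsum m S := by
          unfold dsum
          rw [Finset.sum_image (inj S h1), ← Finset.sum_neg_distrib]
          apply Finset.sum_congr rfl
          intro k hk
          have := Finset.mem_range.1 (h1 hk)
          omega
        rw [this]; omega
    · intro S hS R hR h
      have hS := Finset.mem_coe.1 hS
      have hR := Finset.mem_coe.1 hR
      rw [Finset.mem_filter, Finset.mem_powersetCard] at hS hR
      have hSR : (S.image (fun k => m - 1 - k)).image (fun k => m - 1 - k)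
        = (R.image (fun k => m - 1 - k)).image (fun k => m - 1 - k) := by
        simp only at h; rw [h]
      have key : ∀ S ⊆ Finset.range m,
          (S.image (fun k => m - 1 - k)).image (fun k => m - 1 - k) = S := by
        intro S hS
        rw [Finset.image_image]
        conv_rhs => rw [← Finset.image_id (s := S)]
        apply Finset.image_congr
        intro k hk
        have := Finset.mem_range.1 (hS hk)
        simp only [Function.comp, id]
        omega
      rwa [key S hS.1.1, key R hR.1.1] at hSR
  omega

/-- Gluing two sets of right-steps. -/
def glue (m : ℕ) (A B : Finset ℕ) : Finset ℕ := A ∪ B.map (addRightEmbedding m)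

lemma glue_disj (m : ℕ) (A B : Finset ℕ) (hA : A ⊆ Finset.range m) :
    Disjoint A (B.map (addRightEmbedding m)) := by
  rw [Finset.disjoint_left]
  intro k hk hk2
  obtain ⟨l, _, rfl⟩ := Finset.mem_map.1 hk2
  have := Finset.mem_range.1 (hA hk)
  simp at this

lemma glue_dsum (m r : ℕ) (A B : Finset ℕ) (hA : A ⊆ Finset.range m) :
    dsum (m + r) (glue m A B) = dsum m A + dsum r B + A.card * r - B.card * m := by
  unfold dsum glue
  rw [Finset.sum_union (glue_disj m A B hA), Finset.sum_map]
  have h1 : ∑ k ∈ A, (((m + r : ℕ) : ℤ) - 1 - 2 * k)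
      = ∑ k ∈ A, ((m : ℤ) - 1 - 2 * k) + A.card * r := by
    rw [← nsmul_eq_mul, ← Finset.sum_const, ← Finset.sum_add_distrib]
    apply Finset.sum_congr rfl; intro k _; push_cast; ring
  have h2 : ∑ k ∈ B, (((m + r : ℕ) : ℤ) - 1 - 2 * ((addRightEmbedding m k : ℕ) : ℤ))
      = ∑ k ∈ B, ((r : ℤ) - 1 - 2 * k) - B.card * m := by
    rw [← nsmul_eq_mul, ← Finset.sum_const, ← Finset.sum_sub_distrib]
    apply Finset.sum_congr rfl; intro k _; simp; ring
  rw [h1, h2]; ring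

lemma glue_left (m : ℕ) (A B : Finset ℕ) (hA : A ⊆ Finset.range m) :
    (glue m A B).filter (· < m) = A := by
  ext k
  simp only [glue, Finset.mem_filter, Finset.mem_union, Finset.mem_map, addRightEmbedding_apply]
  constructor
  · rintro ⟨h | ⟨l, _, rfl⟩, h2⟩
    · exact h
    · omega
  · intro h; exact ⟨Or.inl h, Finset.mem_range.1 (hA h)⟩

lemma glue_right (m : ℕ) (A B : Finset ℕ) (hA : A ⊆ Finset.range m) (k : ℕ) :
    k + m ∈ glue m A B ↔ k ∈ B := by
  simp only [glue, Finset.mem_union, Finset.mem_map, addRightEmbedding_apply]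
  constructor
  · rintro (h | ⟨l, hl, h⟩)
    · have := Finset.mem_range.1 (hA h); omega
    · have : l = k := by omega
      rwa [← this]
  · intro h; exact Or.inr ⟨k, h, rfl⟩

lemma glue_count (T : ℝ) (m r a : ℕ) :
    ∑ j ∈ (Finset.range (a + 1)).filter
      (fun j : ℕ => T ≤ (j : ℝ) * (m + r : ℕ) - a * m), wgt (m + r) a m j ≤
    4 * ((((Finset.range (m + r)).powersetCard a).filter
      (fun S => T ≤ (dsum (m + r) S : ℝ))).card : ℝ) := by
  set J := (Finset.range (a + 1)).filter
      (fun j : ℕ => T ≤ (j : ℝ) * (m + r : ℕ) - a * m) with hJ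
  set good : ℕ → ℕ → Finset (Finset ℕ) := fun m j =>
    ((Finset.range m).powersetCard j).filter (fun S => 0 ≤ dsum m S) with hgood
  have hcount : ∑ j ∈ J, (good m j).card * (good r (a - j)).card ≤
      (((Finset.range (m + r)).powersetCard a).filter
      (fun S => T ≤ (dsum (m + r) S : ℝ))).card := by
    have : ∑ j ∈ J, (good m j).card * (good r (a - j)).card
        = (J.sigma (fun j => good m j ×ˢ good r (a - j))).card := by
      rw [Finset.card_sigma]; simp
    rw [this]
    apply Finset.card_le_card_of_injOn (fun p => glue m p.2.1 p.2.2)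
    · rintro ⟨j, A, B⟩ hp
      have hp := Finset.mem_coe.1 hp
      simp only [Finset.mem_sigma, Finset.mem_product, hJ, hgood, Finset.mem_filter,
        Finset.mem_powersetCard, Finset.mem_range] at hp
      obtain ⟨⟨h1, h2⟩, ⟨⟨h3, h4⟩, h5⟩, ⟨h6, h7⟩, h8⟩ := hp
      refine Finset.mem_coe.2 ?_
      simp only [Finset.mem_filter, Finset.mem_powersetCard]
      refine ⟨⟨?_, ?_⟩, ?_⟩
      · intro k hk
        simp only [glue, Finset.mem_union, Finset.mem_map, addRightEmbedding_apply] at hk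
        rw [Finset.mem_range]
        rcases hk with h | ⟨l, hl, rfl⟩
        · have := Finset.mem_range.1 (h3 h); omega
        · have := Finset.mem_range.1 (h6 hl); omega
      · rw [glue, Finset.card_union_of_disjoint (glue_disj m A B h3), Finset.card_map]; omega
      · rw [glue_dsum m r A B h3, h4, h7]
        have h9 : (0 : ℝ) ≤ dsum m A := by exact_mod_cast h5
        have h10 : (0 : ℝ) ≤ dsum r B := by exact_mod_cast h8
        push_cast [Nat.cast_sub (show j ≤ a by omega)] at h2 ⊢
        linarith
    · rintro ⟨j, A, B⟩ hp ⟨j', A', B'⟩ hp' h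
      have hp := Finset.mem_coe.1 hp
      have hp' := Finset.mem_coe.1 hp'
      simp only [Finset.mem_sigma, Finset.mem_product, hJ, hgood, Finset.mem_filter,
        Finset.mem_powersetCard] at hp hp'
      obtain ⟨_, ⟨⟨h3, h4⟩, _⟩, _⟩ := hp
      obtain ⟨_, ⟨⟨h3', h4'⟩, _⟩, _⟩ := hp'
      simp only at h
      have e1 : A = A' := by rw [← glue_left m A B h3, h, glue_left m A' B' h3']
      have e2 : B = B' := by
        ext k
        rw [← glue_right m A B h3, h, glue_right m A' B' h3']
      subst e1 e2
      subst h4 h4'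
      rfl
  have hc : ((∑ j ∈ J, (good m j).card * (good r (a - j)).card : ℕ) : ℝ) ≤
      (((Finset.range (m + r)).powersetCard a).filter
      (fun S => T ≤ (dsum (m + r) S : ℝ))).card := by exact_mod_cast hcount
  refine le_trans ?_ (mul_le_mul_of_nonneg_left hc (by norm_num : (0 : ℝ) ≤ 4))
  push_cast
  rw [Finset.mul_sum]
  apply Finset.sum_le_sum
  intro j _
  have h1 := dsum_reflect m j
  have h2 := dsum_reflect r (a - j)
  rw [Finset.card_powersetCard, Finset.card_range] at h1 h2
  have h3 := Nat.mul_le_mul h1 h2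
  unfold wgt
  rw [Nat.add_sub_cancel_left]
  have h4 : ((m.choose j * r.choose (a - j) : ℕ) : ℝ) ≤
    ((2 * (good m j).card * (2 * (good r (a - j)).card) : ℕ) : ℝ) := by exact_mod_cast h3
  push_cast at h4
  linarith

/-- number of right-steps before time `k` -/
def cnt (S : Finset ℕ) (k : ℕ) : ℕ := (S.filter (· < k)).card

lemma cnt_zero (S : Finset ℕ) : cnt S 0 = 0 := by simp [cnt]

lemma cnt_succ (S : Finset ℕ) (k : ℕ) : cnt S (k + 1) = cnt S k + if k ∈ S then 1 else 0 := by
  unfold cnt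
  split_ifs with h
  · have : S.filter (· < k + 1) = insert k (S.filter (· < k)) := by
      ext l; simp only [Finset.mem_filter, Finset.mem_insert]
      constructor
      · rintro ⟨h1, h2⟩
        rcases Nat.lt_succ_iff_lt_or_eq.1 h2 with h3 | h3
        · exact Or.inr ⟨h1, h3⟩
        · exact Or.inl h3
      · rintro (rfl | ⟨h1, h2⟩)
        · exact ⟨h, by omega⟩
        · exact ⟨h1, by omega⟩
    rw [this, Finset.card_insert_of_notMem (by simp)]
  · rw [add_zero]; congr 1
    ext l; simp only [Finset.mem_filter]
    constructor
    · rintro ⟨h1, h2⟩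
      refine ⟨h1, ?_⟩
      rcases Nat.lt_succ_iff_lt_or_eq.1 h2 with h3 | h3
      · exact h3
      · subst h3; exact absurd h1 h
    · rintro ⟨h1, h2⟩; exact ⟨h1, by omega⟩

lemma cnt_full (S : Finset ℕ) (n k : ℕ) (hS : S ⊆ Finset.range n) (hk : n ≤ k) :
    cnt S k = S.card := by
  unfold cnt
  congr 1
  apply Finset.filter_true_of_mem
  intro l hl
  have := Finset.mem_range.1 (hS hl); omega

/-- the path with given right-step times -/
def mkPath (n : ℕ) (x : ℤ × ℤ) (S : Finset ℕ) (k : ℕ) : ℤ × ℤ :=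
  (x.1 + cnt S k, x.2 - (min k n : ℕ) + cnt S k)

lemma mkPath_succ (n : ℕ) (x : ℤ × ℤ) (S : Finset ℕ) (k : ℕ) (hk : k < n) :
    mkPath n x S (k + 1) = if k ∈ S then ((mkPath n x S k).1 + 1, (mkPath n x S k).2)
      else ((mkPath n x S k).1, (mkPath n x S k).2 - 1) := by
  unfold mkPath
  rw [cnt_succ, min_eq_left hk.le, min_eq_left (by omega : k + 1 ≤ n)]
  split_ifs
  · ext
    · push_cast; ring
    · push_cast; ring
  · ext
    · push_cast; ring
    · push_cast; ring

lemma mkPath_isPath (n a : ℕ) (x y : ℤ × ℤ) (S : Finset ℕ) (hS : S ⊆ Finset.range n)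
    (hc : S.card = a) (h1 : y.1 = x.1 + a) (h2 : y.2 = x.2 - n + a) :
    IsPathBtw n x y (mkPath n x S) := by
  refine ⟨⟨?_, ?_⟩, ?_, ?_⟩
  · intro k hk
    rw [mkPath_succ n x S k hk]
    unfold IsStep
    split_ifs
    · exact Or.inl rfl
    · exact Or.inr rfl
  · intro k hk
    unfold mkPath
    rw [cnt_full S n k hS hk, cnt_full S n n hS le_rfl, min_eq_right hk, min_self]
  · unfold mkPath; simp [cnt_zero]
  · unfold mkPath
    rw [cnt_full S n n hS le_rfl, min_self, hc]
    ext
    · simp [h1]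
    · simp [h2]

lemma mkPath_mem (n : ℕ) (x : ℤ × ℤ) (S : Finset ℕ) (k : ℕ) (hk : k < n) :
    k ∈ S ↔ (mkPath n x S (k + 1)).1 = (mkPath n x S k).1 + 1 := by
  rw [mkPath_succ n x S k hk]
  split_ifs with h <;> simp [h]

lemma mkPath_inj (n : ℕ) (x : ℤ × ℤ) (S R : Finset ℕ) (hS : S ⊆ Finset.range n)
    (hR : R ⊆ Finset.range n) (h : mkPath n x S = mkPath n x R) : S = R := by
  ext k
  by_cases hk : k < n
  · rw [mkPath_mem n x S k hk, mkPath_mem n x R k hk, h]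
  · constructor
    · intro h; exact absurd (Finset.mem_range.1 (hS h)) hk
    · intro h; exact absurd (Finset.mem_range.1 (hR h)) hk

lemma mkPath_surj (n a : ℕ) (x y : ℤ × ℤ) (h1 : y.1 = x.1 + a)
    (γ : ℕ → ℤ × ℤ) (hγ : IsPathBtw n x y γ) :
    ∃ S, S ⊆ Finset.range n ∧ S.card = a ∧ mkPath n x S = γ := by
  obtain ⟨⟨hs, ht⟩, h0, hn⟩ := hγ
  set S := (Finset.range n).filter (fun k => (γ (k + 1)).1 = (γ k).1 + 1) with hS
  have hSn : S ⊆ Finset.range n := Finset.filter_subset _ _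
  have hle : ∀ k, k ≤ n → mkPath n x S k = γ k := by
    intro k
    induction k with
    | zero => intro _; rw [h0]; unfold mkPath; simp [cnt_zero]
    | succ k ih =>
      intro hk
      have hk' : k < n := hk
      rw [mkPath_succ n x S k hk', ih hk'.le]
      have hmem : k ∈ S ↔ (γ (k + 1)).1 = (γ k).1 + 1 := by
        rw [hS, Finset.mem_filter, Finset.mem_range]; simp [hk']
      rcases hs k hk' with h | h
      · rw [if_pos (hmem.2 (by rw [h])), h]
      · rw [if_neg (fun h' => by have := hmem.1 h'; rw [h] at this; simp at this), h]
  refine ⟨S, hSn, ?_, ?_⟩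
  · have := hle n le_rfl
    rw [hn] at this
    have := congrArg Prod.fst this
    unfold mkPath at this
    rw [cnt_full S n n hSn le_rfl, h1] at this
    simpa using this
  · funext k
    rcases le_total k n with h | h
    · exact hle k h
    · rw [ht k h, ← hle n le_rfl]
      unfold mkPath
      rw [cnt_full S n k hSn h, cnt_full S n n hSn le_rfl, min_eq_right h, min_self]

lemma mkPath_excess (n : ℕ) (x : ℤ × ℤ) (S : Finset ℕ) (hS : S ⊆ Finset.range n) :
    excessArea2 n (mkPath n x S) = dsum n S := by
  have key : ∀ i, i ≤ n → cross (mkPath n x S 0) (mkPath n x S i) -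
      ∑ k ∈ Finset.range i, cross (mkPath n x S k) (mkPath n x S (k + 1))
      = ∑ k ∈ Finset.range i, if k ∈ S then ((i : ℤ) - 1 - 2 * k) else 0 := by
    intro i
    induction i with
    | zero => intro _; simp [cross]; ring
    | succ i ih =>
      intro hi
      have ih := ih (by omega)
      rw [Finset.sum_range_succ, Finset.sum_range_succ]
      have hc : ∀ i : ℕ, (∑ k ∈ Finset.range i, if k ∈ S then (1 : ℤ) else 0) = cnt S i := by
        intro i
        induction i with
        | zero => simp [cnt_zero]
        | succ i ih => rw [Finset.sum_range_succ, ih, cnt_succ]; push_cast; rfl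
      have h1 : (∑ k ∈ Finset.range i, if k ∈ S then (((i + 1 : ℕ) : ℤ) - 1 - 2 * k) else 0)
          = (∑ k ∈ Finset.range i, if k ∈ S then ((i : ℤ) - 1 - 2 * k) else 0) + cnt S i := by
        rw [← hc, ← Finset.sum_add_distrib]
        apply Finset.sum_congr rfl
        intro k _
        split_ifs
        · push_cast; ring
        · simp
      rw [h1, ← ih, mkPath_succ n x S i (by omega)]
      have e0 : mkPath n x S 0 = x := by unfold mkPath; simp [cnt_zero]
      have ei : mkPath n x S i = (x.1 + cnt S i, x.2 - i + cnt S i) := by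
        unfold mkPath; rw [min_eq_left (by omega)]
      rw [e0, ei]
      unfold cross
      split_ifs
      · push_cast; ring
      · push_cast; ring
  unfold excessArea2
  rw [key n le_rfl]
  unfold dsum
  rw [← Finset.sum_filter]
  congr 1
  ext k
  simp only [Finset.mem_filter, Finset.mem_range]
  exact ⟨fun h => h.2, fun h => ⟨Finset.mem_range.1 (hS h), h⟩⟩

lemma card_paths (n a : ℕ) (x y : ℤ × ℤ) (h1 : y.1 = x.1 + a) (h2 : y.2 = x.2 - n + a)
    (P : ℤ → Prop) [DecidablePred P] :
    Nat.card {γ : ℕ → ℤ × ℤ // IsPathBtw n x y γ ∧ P (excessArea2 n γ)}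
      = (((Finset.range n).powersetCard a).filter (fun S => P (dsum n S))).card := by
  have hset : {γ : ℕ → ℤ × ℤ | IsPathBtw n x y γ ∧ P (excessArea2 n γ)}
      = Set.image (mkPath n x) (((Finset.range n).powersetCard a).filter
        (fun S => P (dsum n S)) : Set (Finset ℕ)) := by
    ext γ
    simp only [Set.mem_ofPred_eq, Set.mem_image, Finset.mem_coe, Finset.mem_filter,
      Finset.mem_powersetCard]
    constructor
    · rintro ⟨hγ, hP⟩
      obtain ⟨S, hS, hc, rfl⟩ := mkPath_surj n a x y h1 γ hγ
      rw [mkPath_excess n x S hS] at hP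
      exact ⟨S, ⟨⟨hS, hc⟩, hP⟩, rfl⟩
    · rintro ⟨S, ⟨⟨hS, hc⟩, hP⟩, rfl⟩
      refine ⟨mkPath_isPath n a x y S hS hc h1 h2, ?_⟩
      rwa [mkPath_excess n x S hS]
  change Nat.card ({γ : ℕ → ℤ × ℤ | IsPathBtw n x y γ ∧ P (excessArea2 n γ)} : Set _) = _
  rw [Nat.card_coe_set_eq, hset, Set.InjOn.ncard_image, Set.ncard_coe_finset]
  intro S hS R hR h
  have hS := Finset.mem_coe.1 hS
  have hR := Finset.mem_coe.1 hR
  rw [Finset.mem_filter, Finset.mem_powersetCard] at hS hR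
  exact mkPath_inj n x S R hS.1.1 hR.1.1 h

/-- Uniform positive probability of good area capture for the simple random walk bridge:
for chord angles in `[ε, π/2 − ε]` and `h = ‖x − y‖ ≥ N₀`, the proportion of down-right
paths from `x` to `y` capturing area exceeding the triangle `0xy` by at least `η h^{3/2}`
is at least `c = c(ε, η) > 0`. -/
theorem stmt18 (ε η : ℝ) (hε0 : 0 < ε) (hε : ε < Real.pi / 4) (hη : 0 < η) :
    ∃ c : ℝ, 0 < c ∧ ∃ N₀ : ℝ, ∀ x y : ℤ × ℤ,
      0 ≤ x.1 → 0 ≤ y.2 → x.1 ≤ y.1 → y.2 ≤ x.2 →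
      ε ≤ Real.arctan (((x.2 - y.2 : ℤ) : ℝ) / ((y.1 - x.1 : ℤ) : ℝ)) →
      Real.arctan (((x.2 - y.2 : ℤ) : ℝ) / ((y.1 - x.1 : ℤ) : ℝ)) ≤ Real.pi / 2 - ε →
      N₀ ≤ Real.sqrt (((y.1 - x.1 : ℤ) : ℝ) ^ 2 + ((x.2 - y.2 : ℤ) : ℝ) ^ 2) →
      c * (Nat.card {γ : ℕ → ℤ × ℤ //
            IsPathBtw ((y.1 - x.1) + (x.2 - y.2)).toNat x y γ} : ℝ)
        ≤ (Nat.card {γ : ℕ → ℤ × ℤ //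
            IsPathBtw ((y.1 - x.1) + (x.2 - y.2)).toNat x y γ ∧
            η * (Real.sqrt (((y.1 - x.1 : ℤ) : ℝ) ^ 2 + ((x.2 - y.2 : ℤ) : ℝ) ^ 2))
                ^ ((3 : ℝ) / 2)
              ≤ (excessArea2 ((y.1 - x.1) + (x.2 - y.2)).toNat γ : ℝ) / 2} : ℝ) := by
  have hκ : 0 < Real.tan ε := Real.tan_pos_of_pos_of_lt_pi_div_two hε0 (by linarith [Real.pi_pos])
  set κ := Real.tan ε with hκd
  have hκ1 : κ < 1 := by
    rw [hκd, ← Real.tan_pi_div_four]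
    exact Real.tan_lt_tan_of_nonneg_of_lt_pi_div_two hε0.le (by linarith [Real.pi_pos]) hε
  set E := Real.exp (144 * (2 * η + 7) / κ ^ 2 * (2 * η + 3)) with hE
  have hE0 : 0 < E := Real.exp_pos _
  refine ⟨1 / (8 * E), by positivity, max 2 ((12 * (2 * η + 5) / κ) ^ 2), ?_⟩
  intro x y _ _ hxy1 hxy2 hang1 hang2 hN
  obtain ⟨a, ha⟩ := Int.eq_ofNat_of_zero_le (show 0 ≤ y.1 - x.1 by omega)
  obtain ⟨b, hb⟩ := Int.eq_ofNat_of_zero_le (show 0 ≤ x.2 - y.2 by omega)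
  rw [ha, hb] at hang1 hang2 hN ⊢
  have hnn : ((a : ℤ) + (b : ℤ)).toNat = a + b := by omega
  rw [hnn]
  simp only [Int.cast_natCast] at hang1 hang2 hN ⊢
  set h := Real.sqrt ((a : ℝ) ^ 2 + (b : ℝ) ^ 2) with hh
  have ha0 : (0 : ℝ) ≤ a := by positivity
  have hb0 : (0 : ℝ) ≤ b := by positivity
  have hhn : h ≤ a + b := by
    rw [hh, Real.sqrt_le_left (by positivity)]
    nlinarith
  have hapos : (0 : ℝ) < a := by
    rcases ha0.lt_or_eq with h | h
    · exact h
    · rw [← h] at hang1; simp at hang1; linarith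
  have hk1 : κ * a ≤ b := by
    have h1 : κ ≤ (b : ℝ) / a := by
      by_contra hcon
      push Not at hcon
      have := Real.arctan_strictMono hcon
      rw [hκd, Real.arctan_tan (by linarith [Real.pi_pos]) (by linarith [Real.pi_pos])] at this
      linarith
    rwa [le_div_iff₀ hapos] at h1
  have hk2 : κ * b ≤ a := by
    have h1 : (b : ℝ) / a ≤ κ⁻¹ := by
      by_contra hcon
      push Not at hcon
      have := Real.arctan_strictMono hcon
      rw [hκd, ← Real.tan_pi_div_two_sub,
        Real.arctan_tan (by linarith [Real.pi_pos]) (by linarith [Real.pi_pos])] at this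
      linarith
    rw [div_le_iff₀ hapos] at h1
    have := mul_le_mul_of_nonneg_left h1 hκ.le
    rwa [← mul_assoc, mul_inv_cancel₀ hκ.ne', one_mul] at this
  have hn2 : 2 ≤ a + b := by
    have : (2 : ℝ) ≤ (a : ℝ) + b := (le_max_left _ _).trans (hN.trans hhn)
    exact_mod_cast this
  have hbig : 12 * (2 * η + 5) ≤ κ * Real.sqrt ((a + b : ℕ) : ℝ) := by
    have h1 : (12 * (2 * η + 5) / κ) ^ 2 ≤ ((a + b : ℕ) : ℝ) := by
      push_cast
      exact (le_max_right _ _).trans (hN.trans hhn)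
    have h2 := Real.le_sqrt_of_sq_le h1
    rw [div_le_iff₀ hκ] at h2
    linarith
  set m := (a + b) / 2 with hm
  have htail := wgt_tail κ η hκ hη (a + b) a m (by omega) (by omega) (by omega)
    (by push_cast; nlinarith) (by push_cast; nlinarith) (by omega) hbig
  have hglue := glue_count (2 * η * (((a + b : ℕ) : ℝ) * Real.sqrt ((a + b : ℕ) : ℝ))) m
    (a + b - m) a
  rw [Nat.add_sub_cancel' (show m ≤ a + b by omega)] at hglue
  have e1 : y.1 = x.1 + a := by omega
  have e2 : y.2 = x.2 - (a + b : ℕ) + a := by push_cast; omega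
  have c1 := card_paths (a + b) a x y e1 e2 (fun _ => True)
  simp only [and_true, Finset.filter_true, Finset.card_powersetCard, Finset.card_range] at c1
  classical
  have c2 := card_paths (a + b) a x y e1 e2
    (fun z : ℤ => η * h ^ ((3 : ℝ) / 2) ≤ (z : ℝ) / 2)
  rw [c1, c2]
  have hpow : h ^ ((3 : ℝ) / 2) ≤ ((a + b : ℕ) : ℝ) * Real.sqrt ((a + b : ℕ) : ℝ) := by
    have hpos : (0 : ℝ) < ((a + b : ℕ) : ℝ) := by exact_mod_cast (by omega : 0 < a + b)
    have h1 : h ^ ((3 : ℝ) / 2) ≤ ((a + b : ℕ) : ℝ) ^ ((3 : ℝ) / 2) :=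
      Real.rpow_le_rpow (Real.sqrt_nonneg _) (by push_cast; exact hhn) (by norm_num)
    refine h1.trans (le_of_eq ?_)
    rw [show (3 : ℝ) / 2 = 1 + 1 / 2 by norm_num, Real.rpow_add hpos, Real.rpow_one,
      Real.sqrt_eq_rpow]
  have hsub : ((((Finset.range (a + b)).powersetCard a).filter
      (fun S => 2 * η * (((a + b : ℕ) : ℝ) * Real.sqrt ((a + b : ℕ) : ℝ))
        ≤ (dsum (a + b) S : ℝ))).card : ℝ) ≤
      ((((Finset.range (a + b)).powersetCard a).filter
      (fun S => η * h ^ ((3 : ℝ) / 2) ≤ (dsum (a + b) S : ℝ) / 2)).card : ℝ) := by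
    have : ∀ S : Finset ℕ, 2 * η * (((a + b : ℕ) : ℝ) * Real.sqrt ((a + b : ℕ) : ℝ))
        ≤ (dsum (a + b) S : ℝ) → η * h ^ ((3 : ℝ) / 2) ≤ (dsum (a + b) S : ℝ) / 2 := by
      intro S hS
      have := mul_le_mul_of_nonneg_left hpow hη.le
      linarith
    exact_mod_cast Finset.card_le_card (Finset.monotone_filter_right _ (fun S _ => this S))
  rw [div_mul_eq_mul_div, one_mul, div_le_iff₀ (by positivity)]
  have h3 := hglue.trans (mul_le_mul_of_nonneg_left hsub (by norm_num : (0 : ℝ) ≤ 4))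
  have h4 := mul_le_mul_of_nonneg_left h3 (show 0 ≤ 2 * E by positivity)
  linarith
end
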